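/- arXiv:2202.10009 — 3 statements merged into one kernel-verified Lean document; each statement's English description precedes it below -/
import Mathlib

section
/- If a variety V has a Taylor term and, whenever x ≤form y in Con(A) for A ∈ V, the equation [x,y] = [y,x] is satisfied, then V has a weak difference term. -/
/-- A (universal-algebraic) signature: a type of operation symbols with arities. -/
structure Sig where
  ops : Type
  arity : ops → ℕ

/-- An algebra for a signature: a carrier set with an interpretation of each
operation symbol. -/
structure Alg (σ : Sig) where
  carrier : Type
  interp : ∀ f : σ.ops, (Fin (σ.arity f) → carrier) → carrier

/-- Terms over a signature with variables from `V`. -/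
inductive Trm (σ : Sig) (V : Type) : Type
  | var : V → Trm σ V
  | op : (f : σ.ops) → (Fin (σ.arity f) → Trm σ V) → Trm σ V

/-- Evaluation of a term in an algebra under an assignment of the variables. -/
def Alg.evalTrm {σ : Sig} (A : Alg σ) {V : Type} (asg : V → A.carrier) :
    Trm σ V → A.carrier
  | .var v => asg v
  | .op f ts => A.interp f fun i => A.evalTrm asg (ts i)

/-- A congruence on an algebra: an equivalence relation compatible with the
basic operations. -/
structure Congruence {σ : Sig} (A : Alg σ) where
  rel : A.carrier → A.carrier → Prop
  iseqv : Equivalence rel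
  compat : ∀ (f : σ.ops) (a b : Fin (σ.arity f) → A.carrier),
    (∀ i, rel (a i) (b i)) → rel (A.interp f a) (A.interp f b)

namespace Congruence

variable {σ : Sig} {A : Alg σ}

theorem ext' {c d : Congruence A} (h : c.rel = d.rel) : c = d := by
  cases c; cases d; cases h; rfl

instance : PartialOrder (Congruence A) where
  le c d := ∀ a b, c.rel a b → d.rel a b
  le_refl c a b h := h
  le_trans c d e h1 h2 a b h := h2 a b (h1 a b h)
  le_antisymm c d h1 h2 :=
    ext' (funext fun a => funext fun b => propext ⟨h1 a b, h2 a b⟩)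

instance : InfSet (Congruence A) where
  sInf S :=
    { rel := fun a b => ∀ c ∈ S, c.rel a b
      iseqv := ⟨fun a c _ => c.iseqv.refl a,
                fun h c hc => c.iseqv.symm (h c hc),
                fun h1 h2 c hc => c.iseqv.trans (h1 c hc) (h2 c hc)⟩
      compat := fun f a b h c hc => c.compat f a b fun i => h i c hc }

/-- The congruences of an algebra form a complete lattice (`⊥` is the equality
congruence, `⊤` is the total congruence, meet is intersection). -/
instance : CompleteLattice (Congruence A) :=
  completeLatticeOfInf _ fun S =>
    ⟨fun c hc a b h => h c hc, fun c hc a b h d hd => hc hd a b h⟩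

end Congruence

/-- `Centralizes S T δ` is the centralizer relation `C(S,T;δ)`: for every
`S,T`-matrix `[[p,q],[r,s]]` (built from a term operation `t`, tuples `a S b`
and `u T v`), if `(p,q) ∈ δ` then `(r,s) ∈ δ`. -/
def Centralizes {σ : Sig} {A : Alg σ} (S T δ : Congruence A) : Prop :=
  ∀ (m n : ℕ) (t : Trm σ (Sum (Fin m) (Fin n)))
    (a b : Fin m → A.carrier) (u v : Fin n → A.carrier),
    (∀ i, S.rel (a i) (b i)) → (∀ j, T.rel (u j) (v j)) →
    δ.rel (A.evalTrm (Sum.elim a u) t) (A.evalTrm (Sum.elim a v) t) →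
    δ.rel (A.evalTrm (Sum.elim b u) t) (A.evalTrm (Sum.elim b v) t)

/-- The commC `[S,T]`: the least congruence `δ` with `C(S,T;δ)`. -/
def commC {σ : Sig} {A : Alg σ} (S T : Congruence A) : Congruence A :=
  sInf {δ | Centralizes S T δ}

/-- The relative commC `[S,T]_ε`: the intersection of all congruences
`γ ≥ ε` with `C(S,T;γ)`. -/
def relCommC {σ : Sig} {A : Alg σ} (S T ε : Congruence A) : Congruence A :=
  sInf {γ | ε ≤ γ ∧ Centralizes S T γ}

/-- The congruence generated by a single pair `(x, y)`. -/
def cgPair {σ : Sig} (A : Alg σ) (x y : A.carrier) : Congruence A :=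
  sInf {c | c.rel x y}

/-- Homomorphisms of algebras. -/
structure UAHom {σ : Sig} (A B : Alg σ) where
  toFun : A.carrier → B.carrier
  map_op : ∀ (f : σ.ops) (a : Fin (σ.arity f) → A.carrier),
    toFun (A.interp f a) = B.interp f (fun i => toFun (a i))

/-- The product of a family of algebras. -/
def prodAlg {σ : Sig} {I : Type} (F : I → Alg σ) : Alg σ where
  carrier := ∀ i, (F i).carrier
  interp f a := fun i => (F i).interp f (fun j => a j i)

/-- A variety: a class of algebras of a fixed signature closed under
homomorphic images, subalgebras (here: isomorphic copies of subalgebras,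
i.e. sources of injective homomorphisms), and arbitrary products. -/
structure Variety (σ : Sig) where
  Mem : Alg σ → Prop
  closed_hom : ∀ {A B : Alg σ}, Mem A →
    (∃ h : UAHom A B, Function.Surjective h.toFun) → Mem B
  closed_sub : ∀ {A B : Alg σ}, Mem A →
    (∃ h : UAHom B A, Function.Injective h.toFun) → Mem B
  closed_prod : ∀ {I : Type} (F : I → Alg σ), (∀ i, Mem (F i)) → Mem (prodAlg F)

/-- The setoid associated with a congruence. -/
def Congruence.setoid {σ : Sig} {A : Alg σ} (c : Congruence A) :
    Setoid A.carrier := ⟨c.rel, c.iseqv⟩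

/-- The quotient algebra of an algebra by a congruence. -/
noncomputable def quotAlg {σ : Sig} (A : Alg σ) (c : Congruence A) : Alg σ where
  carrier := Quotient c.setoid
  interp f a := Quotient.mk c.setoid (A.interp f fun i => (a i).out)

/-- `algOn A α` is the algebra `A(α)`: the subalgebra of `A × A` whose
universe is `α`. -/
def algOn {σ : Sig} (A : Alg σ) (α : Congruence A) : Alg σ where
  carrier := {p : A.carrier × A.carrier // α.rel p.1 p.2}
  interp f a := ⟨(A.interp f fun i => (a i).1.1, A.interp f fun i => (a i).1.2),
    α.compat f _ _ fun i => (a i).2⟩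

/-- The kernel of the first coordinate projection of `A(α)`. -/
def eta1 {σ : Sig} (A : Alg σ) (α : Congruence A) : Congruence (algOn A α) where
  rel p q := p.1.1 = q.1.1
  iseqv := ⟨fun _ => rfl, Eq.symm, Eq.trans⟩
  compat f a b h := congrArg (A.interp f) (funext h)

/-- The kernel of the second coordinate projection of `A(α)`. -/
def eta2 {σ : Sig} (A : Alg σ) (α : Congruence A) : Congruence (algOn A α) where
  rel p q := p.1.2 = q.1.2
  iseqv := ⟨fun _ => rfl, Eq.symm, Eq.trans⟩
  compat f a b h := congrArg (A.interp f) (funext h)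

/-- The congruence `Δ_{α,β}` on `A(α)` generated by the `β`-diagonal pairs. -/
def diagDelta {σ : Sig} (A : Alg σ) (α β : Congruence A) :
    Congruence (algOn A α) :=
  sInf {c | ∀ x z : A.carrier, β.rel x z →
    c.rel ⟨(x, x), α.iseqv.refl x⟩ ⟨(z, z), α.iseqv.refl z⟩}

/-- A pentagon (five-element sublattice isomorphic to `N₅`) in the congruence
lattice with bottom `z`, side element `β`, critical chain `δ < θ`, and top `α`. -/
def IsPentagon {σ : Sig} {A : Alg σ} (z β δ θ α : Congruence A) : Prop :=
  δ < θ ∧ β ⊓ θ = z ∧ β ⊓ δ = z ∧ β ⊔ δ = α ∧ β ⊔ θ = α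

/-- Two congruences permute: `c ∘ d = d ∘ c`. -/
def Permutes {σ : Sig} {A : Alg σ} (c d : Congruence A) : Prop :=
  ∀ a b : A.carrier, (∃ x, c.rel a x ∧ d.rel x b) ↔ (∃ x, d.rel a x ∧ c.rel x b)

/-- `T` is a Taylor term for the variety `V`: an idempotent term satisfying an
`i`-th place Taylor identity for every place `i`. -/
def IsTaylorTrm {σ : Sig} (V : Variety σ) {n : ℕ} (T : Trm σ (Fin n)) : Prop :=
  0 < n ∧
  (∀ A : Alg σ, V.Mem A → ∀ c : A.carrier, A.evalTrm (fun _ => c) T = c) ∧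
  (∀ i : Fin n, ∃ w z : Fin n → Bool, w i ≠ z i ∧
    ∀ A : Alg σ, V.Mem A → ∀ x y : A.carrier,
      A.evalTrm (fun j => cond (w j) x y) T = A.evalTrm (fun j => cond (z j) x y) T)

/-- `V` has a Taylor term. -/
def HasTaylorTrm {σ : Sig} (V : Variety σ) : Prop :=
  ∃ (n : ℕ) (T : Trm σ (Fin n)), IsTaylorTrm V T

/-- A congruence is abelian if `[α,α] = 0`. -/
def IsAbelianCong {σ : Sig} {A : Alg σ} (α : Congruence A) : Prop :=
  commC α α = ⊥

/-- `d` is a weak difference term for `V`: `d(a,a,b) = b` and `d(a,b,b) = a`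
whenever the pair `(a,b)` lies in an abelian congruence of a member of `V`. -/
def IsWeakDifferenceTrm {σ : Sig} (V : Variety σ) (d : Trm σ (Fin 3)) : Prop :=
  ∀ A : Alg σ, V.Mem A → ∀ α : Congruence A, IsAbelianCong α →
    ∀ a b : A.carrier, α.rel a b →
      A.evalTrm ![a, a, b] d = b ∧ A.evalTrm ![a, b, b] d = a

/-- `d` is a difference term for `V`: `V ⊨ d(x,x,y) ≈ y` and `d(a,b,b) = a`
whenever the pair `(a,b)` lies in an abelian congruence of a member of `V`. -/
def IsDifferenceTrm {σ : Sig} (V : Variety σ) (d : Trm σ (Fin 3)) : Prop :=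
  (∀ A : Alg σ, V.Mem A → ∀ a b : A.carrier, A.evalTrm ![a, a, b] d = b) ∧
  (∀ A : Alg σ, V.Mem A → ∀ α : Congruence A, IsAbelianCong α →
    ∀ a b : A.carrier, α.rel a b → A.evalTrm ![a, b, b] d = a)

/-- The commC is left distributive throughout `V`. -/
def CommLeftDistrib {σ : Sig} (V : Variety σ) : Prop :=
  ∀ A : Alg σ, V.Mem A → ∀ x y z : Congruence A,
    commC (x ⊔ y) z = commC x z ⊔ commC y z

/-- The commC is right distributive throughout `V`. -/
def CommRightDistrib {σ : Sig} (V : Variety σ) : Prop :=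
  ∀ A : Alg σ, V.Mem A → ∀ x y z : Congruence A,
    commC x (y ⊔ z) = commC x y ⊔ commC x z

/-- The commC is commutative throughout `V`. -/
def CommutativeCommutator {σ : Sig} (V : Variety σ) : Prop :=
  ∀ A : Alg σ, V.Mem A → ∀ x y : Congruence A, commC x y = commC y x

/-- `V` is congruence modular. -/
def CongruenceModular {σ : Sig} (V : Variety σ) : Prop :=
  ∀ A : Alg σ, V.Mem A → IsModularLattice (Congruence A)

def Trm.bnd {σ : Sig} {V W : Type} (s : V → Trm σ W) : Trm σ V → Trm σ W
  | .var v => s v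
  | .op f ts => .op f fun i => (ts i).bnd s

theorem eval_bnd {σ : Sig} (A : Alg σ) {V W : Type} (s : V → Trm σ W) (asg : W → A.carrier)
    (t : Trm σ V) : A.evalTrm asg (t.bnd s) = A.evalTrm (fun v => A.evalTrm asg (s v)) t := by
  induction t with
  | var v => rfl
  | op f ts ih =>
    simp only [Trm.bnd, Alg.evalTrm]
    congr 1; funext i; exact ih i

theorem eval_congr {σ : Sig} {A : Alg σ} (c : Congruence A) {V : Type} (a b : V → A.carrier)
    (h : ∀ v, c.rel (a v) (b v)) (t : Trm σ V) : c.rel (A.evalTrm a t) (A.evalTrm b t) := by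
  induction t with
  | var v => exact h v
  | op f ts ih => exact c.compat f _ _ ih

theorem eval_hom {σ : Sig} {A B : Alg σ} (h : UAHom A B) {V : Type} (a : V → A.carrier)
    (t : Trm σ V) : h.toFun (A.evalTrm a t) = B.evalTrm (fun v => h.toFun (a v)) t := by
  induction t with
  | var v => rfl
  | op f ts ih =>
    simp only [Alg.evalTrm]
    rw [h.map_op]
    congr 1; funext i; exact ih i

theorem bot_rel {σ : Sig} {A : Alg σ} {a b : A.carrier} :
    (⊥ : Congruence A).rel a b ↔ a = b := by
  constructor
  · intro h
    let e : Congruence A := ⟨fun a b => a = b, ⟨fun _ => rfl, Eq.symm, Eq.trans⟩,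
      fun f a b h => congrArg _ (funext h)⟩
    have : (⊥ : Congruence A) ≤ e := bot_le
    exact this a b h
  · rintro rfl
    exact (⊥ : Congruence A).iseqv.refl a

theorem commC_central {σ : Sig} {A : Alg σ} (S T : Congruence A) :
    Centralizes S T (commC S T) := by
  intro m n t a b u v hab huv h c hc
  exact hc m n t a b u v hab huv (h c hc)

theorem commC_bot {σ : Sig} {A : Alg σ} {S T : Congruence A} :
    commC S T = ⊥ ↔ Centralizes S T ⊥ := by
  constructor
  · intro h; rw [← h]; exact commC_central S T
  · intro h
    exact le_bot_iff.1 (sInf_le h)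

theorem central_fin {σ : Sig} {A : Alg σ} {S T δ : Congruence A} (h : Centralizes S T δ)
    {M N : Type} [Finite M] [Finite N] (t : Trm σ (M ⊕ N))
    (a b : M → A.carrier) (u v : N → A.carrier)
    (hab : ∀ i, S.rel (a i) (b i)) (huv : ∀ j, T.rel (u j) (v j))
    (h0 : δ.rel (A.evalTrm (Sum.elim a u) t) (A.evalTrm (Sum.elim a v) t)) :
    δ.rel (A.evalTrm (Sum.elim b u) t) (A.evalTrm (Sum.elim b v) t) := by
  obtain ⟨m, ⟨eM⟩⟩ := Finite.exists_equiv_fin M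
  obtain ⟨n, ⟨eN⟩⟩ := Finite.exists_equiv_fin N
  have key : ∀ (a : M → A.carrier) (u : N → A.carrier),
      A.evalTrm (Sum.elim (a ∘ eM.symm) (u ∘ eN.symm))
        (t.bnd (fun w => .var (Sum.map eM eN w))) = A.evalTrm (Sum.elim a u) t := by
    intro a u
    rw [eval_bnd]
    congr 1; funext w
    rcases w with w | w <;> simp [Alg.evalTrm]
  have := h m n (t.bnd (fun w => .var (Sum.map eM eN w)))
    (a ∘ eM.symm) (b ∘ eM.symm) (u ∘ eN.symm) (v ∘ eN.symm)
    (fun i => hab _) (fun j => huv _)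
  simp only [key] at this
  exact this h0

theorem algOn_fst {σ : Sig} {A : Alg σ} {α : Congruence A} {V : Type}
    (a : V → (algOn A α).carrier) (t : Trm σ V) :
    ((algOn A α).evalTrm a t).1.1 = A.evalTrm (fun v => (a v).1.1) t :=
  eval_hom (A := algOn A α) (B := A) ⟨fun p => p.1.1, fun _ _ => rfl⟩ a t

theorem algOn_snd {σ : Sig} {A : Alg σ} {α : Congruence A} {V : Type}
    (a : V → (algOn A α).carrier) (t : Trm σ V) :
    ((algOn A α).evalTrm a t).1.2 = A.evalTrm (fun v => (a v).1.2) t :=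
  eval_hom (A := algOn A α) (B := A) ⟨fun p => p.1.2, fun _ _ => rfl⟩ a t

theorem algOn_mem {σ : Sig} (V : Variety σ) {A : Alg σ} (hA : V.Mem A) (α : Congruence A) :
    V.Mem (algOn A α) := by
  refine V.closed_sub (V.closed_prod (fun _ : Bool => A) fun _ => hA)
    ⟨⟨fun p i => cond i p.1.1 p.1.2, ?_⟩, ?_⟩
  · intro f a
    funext i
    cases i <;> rfl
  · intro p q h
    have h1 := congrFun h true
    have h2 := congrFun h false
    exact Subtype.ext (Prod.ext h1 h2)

noncomputable def quotHom {σ : Sig} (A : Alg σ) (c : Congruence A) : UAHom A (quotAlg A c) where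
  toFun := Quotient.mk c.setoid
  map_op f a := by
    apply Quotient.sound
    apply c.compat
    intro i
    exact c.iseqv.symm (Quotient.exact (Quotient.out_eq (Quotient.mk c.setoid (a i))))

theorem quot_mem {σ : Sig} (V : Variety σ) {A : Alg σ} (hA : V.Mem A) (c : Congruence A) :
    V.Mem (quotAlg A c) :=
  V.closed_hom hA ⟨quotHom A c, Quotient.mk_surjective⟩

/-- Image of a congruence above `c` in the quotient. -/
def quotCong {σ : Sig} {A : Alg σ} (c d : Congruence A) (h : c ≤ d) :
    Congruence (quotAlg A c) where
  rel p q := d.rel (Quotient.out p) (Quotient.out q)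
  iseqv := ⟨fun _ => d.iseqv.refl _, fun h => d.iseqv.symm h, fun h h' => d.iseqv.trans h h'⟩
  compat f a b hab := by
    have out : ∀ z, c.rel (Quotient.out (Quotient.mk c.setoid z)) z := fun z =>
      Quotient.exact (Quotient.out_eq (Quotient.mk c.setoid z))
    exact d.iseqv.trans (h _ _ (out _)) (d.iseqv.trans (d.compat f _ _ hab)
      (d.iseqv.symm (h _ _ (out _))))

theorem quot_out {σ : Sig} {A : Alg σ} (c : Congruence A) (z : A.carrier) :
    c.rel (Quotient.out (Quotient.mk c.setoid z)) z :=
  Quotient.exact (Quotient.out_eq (Quotient.mk c.setoid z))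

theorem central_quot {σ : Sig} {A : Alg σ} {c S T : Congruence A} (hS : c ≤ S) (hT : c ≤ T) :
    Centralizes (quotCong c S hS) (quotCong c T hT) ⊥ ↔ Centralizes S T c := by
  have ev : ∀ {V : Type} (a : V → A.carrier) (t : Trm σ V),
      (quotAlg A c).evalTrm (fun v => (quotHom A c).toFun (a v)) t
        = Quotient.mk c.setoid (A.evalTrm a t) := fun a t => (eval_hom (quotHom A c) a t).symm
  constructor
  · intro h m n t a b u v hab huv h0
    have := h m n t (fun i => (quotHom A c).toFun (a i)) (fun i => (quotHom A c).toFun (b i))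
      (fun i => (quotHom A c).toFun (u i)) (fun i => (quotHom A c).toFun (v i))
      (fun i => S.iseqv.trans (hS _ _ (quot_out c _)) (S.iseqv.trans (hab i)
        (S.iseqv.symm (hS _ _ (quot_out c _)))))
      (fun i => T.iseqv.trans (hT _ _ (quot_out c _)) (T.iseqv.trans (huv i)
        (T.iseqv.symm (hT _ _ (quot_out c _)))))
    have e : ∀ (a : Fin m → A.carrier) (u : Fin n → A.carrier),
      Sum.elim (fun i => (quotHom A c).toFun (a i)) (fun i => (quotHom A c).toFun (u i))
        = fun w => (quotHom A c).toFun (Sum.elim a u w) := by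
      intro a u; funext w; cases w <;> rfl
    simp only [e, ev] at this
    have h1 : Quotient.mk c.setoid (A.evalTrm (Sum.elim a u) t)
      = Quotient.mk c.setoid (A.evalTrm (Sum.elim a v) t) := Quotient.sound (s := c.setoid) h0
    exact Quotient.exact (bot_rel.1 (this (bot_rel.2 h1)))
  · intro h m n t a b u v hab huv h0
    have e : ∀ (a : Fin m → (quotAlg A c).carrier) (u : Fin n → (quotAlg A c).carrier),
      (quotAlg A c).evalTrm (Sum.elim a u) t = Quotient.mk c.setoid
        (A.evalTrm (Sum.elim (fun i => Quotient.out (a i)) (fun i => Quotient.out (u i))) t) := by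
      intro a u
      rw [← ev]
      congr 1
      funext w
      cases w <;> exact (Quotient.out_eq _).symm
    rw [bot_rel, e, e] at h0 ⊢
    apply Quotient.sound
    exact h m n t _ _ _ _ hab huv (Quotient.exact h0)

theorem central_symm {σ : Sig} (V : Variety σ)
    (hcomm : ∀ A : Alg σ, V.Mem A → ∀ x y : Congruence A, x ≤ y → commC x y = commC y x)
    {A : Alg σ} (hA : V.Mem A) {c S T : Congruence A} (hS : c ≤ S) (hST : S ≤ T)
    (h : Centralizes S T c) : Centralizes T S c := by
  have hT := hS.trans hST
  rw [← central_quot hT hS, ← commC_bot,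
    ← hcomm _ (quot_mem V hA c) (quotCong c S hS) (quotCong c T hT) (fun a b h => hST _ _ h),
    commC_bot, central_quot]
  exact h

/-- The Taylor term lemma. -/
theorem taylor_step {σ : Sig} (V : Variety σ) (hV : HasTaylorTrm V) {B : Alg σ} (hB : V.Mem B)
    (α : Congruence B) (x y : B.carrier) (hxy : α.rel x y) (hyx : α.rel y x)
    (αh ρ : Congruence (algOn B α))
    (hαh : ∀ p q : (algOn B α).carrier, α.rel p.1.1 q.1.1 → αh.rel p q)
    (hc : Centralizes αh (eta1 B α) ρ)
    (h0 : ρ.rel ⟨(y, x), hyx⟩ ⟨(y, y), α.iseqv.refl y⟩) :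
    ρ.rel ⟨(x, x), α.iseqv.refl x⟩ ⟨(x, y), hxy⟩ := by
  classical
  obtain ⟨n, T, hn, hid, hw⟩ := hV
  have hall : ∀ s t : Bool, α.rel (cond s x y) (cond t x y) := by
    intro s t
    cases s <;> cases t <;> first | exact α.iseqv.refl _ | exact hxy | exact hyx
  let E : Bool → Bool → (algOn B α).carrier := fun s t => ⟨(cond s x y, cond t x y), hall s t⟩
  change ρ.rel (E true true) (E true false)
  have h0' : ρ.rel (E false true) (E false false) := h0
  have hw' : ∀ i : Fin n, ∃ w z : Fin n → Bool, w i = false ∧ z i = true ∧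
      B.evalTrm (fun j => cond (w j) x y) T = B.evalTrm (fun j => cond (z j) x y) T := by
    intro i
    obtain ⟨w, z, hne, hwz⟩ := hw i
    cases hwi : w i
    · refine ⟨w, z, hwi, ?_, hwz B hB x y⟩
      rw [hwi] at hne; cases hz : z i <;> simp_all
    · refine ⟨z, w, ?_, hwi, (hwz B hB x y).symm⟩
      rw [hwi] at hne; cases hz : z i <;> simp_all
  have step : ∀ (i : Fin n) (τ : Fin n → Bool),
      ρ.rel ((algOn B α).evalTrm (fun j => E true (if j = i then true else τ j)) T)
        ((algOn B α).evalTrm (fun j => E true (if j = i then false else τ j)) T) := by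
    intro i τ
    obtain ⟨w, z, hwi, hzi, hwz⟩ := hw' i
    have tr : ∀ t : Fin n → Bool, (algOn B α).evalTrm (fun j => E (w j) (t j)) T
        = (algOn B α).evalTrm (fun j => E (z j) (t j)) T := by
      intro t
      apply Subtype.ext
      apply Prod.ext
      · rw [algOn_fst, algOn_fst]; exact hwz
      · rw [algOn_snd, algOn_snd]
    have r1 : ρ.rel ((algOn B α).evalTrm (fun j => E (w j) true) T)
        ((algOn B α).evalTrm (fun j => E (w j) (if j = i then false else true)) T) := by
      apply eval_congr
      intro j
      by_cases hj : j = i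
      · subst hj; simp only [hwi, if_true]; exact h0'
      · simp only [hj, if_false]; exact ρ.iseqv.refl _
    rw [tr, tr] at r1
    let T' : Trm σ (Fin n ⊕ Unit) := T.bnd fun j => if j = i then .var (.inr ()) else .var (.inl j)
    have ev : ∀ (a : Fin n → (algOn B α).carrier) (u : Unit → (algOn B α).carrier),
        (algOn B α).evalTrm (Sum.elim a u) T'
          = (algOn B α).evalTrm (fun j => if j = i then u () else a j) T := by
      intro a u
      simp only [T', eval_bnd]
      congr 1; funext j
      split_ifs <;> rfl
    have := central_fin hc T' (fun j => E (z j) true) (fun j => E true (τ j))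
      (fun _ => E true true) (fun _ => E true false)
      (fun j => hαh _ _ (hall (z j) true)) (fun _ => rfl)
    simp only [ev] at this
    have e1 : ∀ (s t : Fin n → Bool) (b : Bool), s i = true →
        (fun j => E (s j) (if j = i then b else t j)) =
        (fun j => if j = i then E true b else E (s j) (t j)) := by
      intro s t b hs
      funext j
      by_cases hj : j = i
      · subst hj; simp [hs]
      · simp [hj]
    have e2 := e1 z (fun _ => true) true hzi
    simp only [ite_self] at e2
    rw [e1 (fun _ => true) τ _ rfl, e1 (fun _ => true) τ _ rfl]
    apply this
    rw [← e2, ← e1 z _ _ hzi]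
    exact r1
  have chain : ∀ S : Finset (Fin n),
      ρ.rel (E true true) ((algOn B α).evalTrm (fun j => E true (if j ∈ S then false else true)) T) := by
    intro S
    induction S using Finset.induction_on with
    | empty =>
      have := hid _ (algOn_mem V hB α) (E true true)
      simp only [Finset.notMem_empty, if_false]
      rw [this]
      exact ρ.iseqv.refl _
    | insert i S hi ih =>
      refine ρ.iseqv.trans ih ?_
      have := step i (fun j => if j ∈ S then false else true)
      convert this using 4
      · rename_i j
        by_cases hj : j = i
        · subst hj; simp [hi]
        · simp [hj]
      · rename_i j
        by_cases hj : j = i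
        · subst hj; simp
        · simp [hj]
  have := chain Finset.univ
  simp only [Finset.mem_univ, if_true] at this
  rwa [hid _ (algOn_mem V hB α) (E true false)] at this

/-- One-directional translation relation. -/
def Q0 {σ : Sig} {B : Alg σ} (α : Congruence B) (x y t t' : B.carrier) : Prop :=
  ∃ e : Trm σ (Fin 3), (∀ p q, α.rel p q → B.evalTrm ![p, q, q] e = p) ∧
    B.evalTrm ![t, x, y] e = t'

theorem Q0_refl {σ : Sig} {B : Alg σ} (α : Congruence B) (x y t : B.carrier) :
    Q0 α x y t t := ⟨.var 0, fun _ _ _ => rfl, rfl⟩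

theorem Q0_trans {σ : Sig} {B : Alg σ} {α : Congruence B} {x y t t' t'' : B.carrier}
    (h : Q0 α x y t t') (h' : Q0 α x y t' t'') : Q0 α x y t t'' := by
  obtain ⟨e, he, h⟩ := h
  obtain ⟨e', he', h'⟩ := h'
  have key : ∀ p q r, B.evalTrm ![p, q, r] (e'.bnd ![e, .var 1, .var 2]) =
      B.evalTrm ![B.evalTrm ![p, q, r] e, q, r] e' := by
    intro p q r
    rw [eval_bnd]
    congr 1; funext i
    fin_cases i <;> rfl
  refine ⟨e'.bnd ![e, .var 1, .var 2], ?_, ?_⟩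
  · intro p q hpq
    rw [key, he p q hpq, he' p q hpq]
  · rw [key, h, h']

theorem Q0_central {σ : Sig} {B : Alg σ} {α : Congruence B} (hα : Centralizes α α ⊥)
    {x y : B.carrier} (hxy : α.rel x y) {M N : Type} [Finite M] [Finite N] (τ : Trm σ (M ⊕ N))
    (a b : M → B.carrier) (u v : N → B.carrier)
    (hab : ∀ i, α.rel (a i) (b i)) (huv : ∀ j, α.rel (u j) (v j))
    (hx : α.rel (B.evalTrm (Sum.elim a v) τ) x)
    (h : Q0 α x y (B.evalTrm (Sum.elim a u) τ) (B.evalTrm (Sum.elim a v) τ)) :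
    Q0 α x y (B.evalTrm (Sum.elim b u) τ) (B.evalTrm (Sum.elim b v) τ) := by
  obtain ⟨e, he, h⟩ := h
  refine ⟨e, he, ?_⟩
  let E : Trm σ (M ⊕ (N ⊕ Fin 2)) := e.bnd
    ![τ.bnd (fun w => .var (Sum.map id Sum.inl w)), .var (.inr (.inr 0)), .var (.inr (.inr 1))]
  have ev : ∀ (a : M → B.carrier) (u : N → B.carrier) (p q : B.carrier),
      B.evalTrm (Sum.elim a (Sum.elim u ![p, q])) E =
        B.evalTrm ![B.evalTrm (Sum.elim a u) τ, p, q] e := by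
    intro a u p q
    simp only [E, eval_bnd]
    congr 1; funext i
    fin_cases i
    · simp only [Fin.zero_eta, Matrix.cons_val_zero, eval_bnd]
      congr 1; funext w
      cases w <;> rfl
    · rfl
    · rfl
  have := central_fin hα E a b (Sum.elim u ![x, y]) (Sum.elim v ![x, x]) hab (by
    rintro (j | j)
    · exact huv j
    · fin_cases j
      · exact α.iseqv.refl _
      · exact α.iseqv.symm hxy)
  simp only [ev, bot_rel] at this
  have hx' : α.rel (B.evalTrm (Sum.elim b v) τ) x := by
    refine α.iseqv.trans (eval_congr α _ _ ?_ τ) hx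
    rintro (j | j)
    · exact α.iseqv.symm (hab j)
    · exact α.iseqv.refl _
  rw [this (by rw [h, he _ _ hx]), he _ _ hx']

/-- evaluate a one-variable polynomial -/
def pev {σ : Sig} (B : Alg σ) {K : Type} (G : Trm σ (Option K)) (s : B.carrier)
    (c : K → B.carrier) : B.carrier := B.evalTrm (fun o => o.elim s c) G

def rhoRel {σ : Sig} {B : Alg σ} (α : Congruence B) (x y : B.carrier)
    (p q : (algOn B α).carrier) : Prop :=
  p.1.1 = q.1.1 ∧ ∀ (K : Type) (_ : Finite K) (G : Trm σ (Option K)) (c c' : K → B.carrier),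
    (∀ k, α.rel (c k) (c' k)) → pev B G p.1.1 c = x →
      Q0 α x y (pev B G p.1.2 c') (pev B G q.1.2 c') ∧
      Q0 α x y (pev B G q.1.2 c') (pev B G p.1.2 c')

def rho {σ : Sig} {B : Alg σ} (α : Congruence B) (x y : B.carrier) :
    Congruence (algOn B α) where
  rel := rhoRel α x y
  iseqv := by
    refine ⟨fun p => ⟨rfl, fun _ _ _ _ _ _ _ => ⟨Q0_refl _ _ _ _, Q0_refl _ _ _ _⟩⟩, ?_, ?_⟩
    · rintro p q ⟨h, h'⟩
      refine ⟨h.symm, fun K i G c c' hc hx => ?_⟩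
      rw [← h] at hx
      exact (h' K i G c c' hc hx).symm
    · rintro p q r ⟨h1, h1'⟩ ⟨h2, h2'⟩
      refine ⟨h1.trans h2, fun K i G c c' hc hx => ?_⟩
      have h3 := h1' K i G c c' hc hx
      rw [h1] at hx
      have h4 := h2' K i G c c' hc hx
      exact ⟨Q0_trans h3.1 h4.1, Q0_trans h4.2 h3.2⟩
  compat := by
    classical
    intro f a b h
    have h1 : ∀ i, (a i).1.1 = (b i).1.1 := fun i => (h i).1
    refine ⟨congrArg (B.interp f) (funext h1), fun K hK G c c' hc hx => ?_⟩
    let a2 : Fin (σ.arity f) → B.carrier := fun i => (a i).1.2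
    let b2 : Fin (σ.arity f) → B.carrier := fun i => (b i).1.2
    have main : ∀ S : Finset (Fin (σ.arity f)),
        Q0 α x y (pev B G (B.interp f a2) c') (pev B G (B.interp f (S.piecewise b2 a2)) c') ∧
        Q0 α x y (pev B G (B.interp f (S.piecewise b2 a2)) c') (pev B G (B.interp f a2) c') := by
      intro S
      induction S using Finset.induction_on with
      | empty => simp only [Finset.piecewise_empty]; exact ⟨Q0_refl _ _ _ _, Q0_refl _ _ _ _⟩
      | insert i S hi ih =>
        let G' : Trm σ (Option (K ⊕ Fin (σ.arity f))) := G.bnd fun o =>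
          o.elim (.op f fun j => if j = i then .var none else .var (some (.inr j)))
            (fun k => .var (some (.inl k)))
        have ev : ∀ s d t, pev B G' s (Sum.elim d t) =
            pev B G (B.interp f (Function.update t i s)) d := by
          intro s d t
          simp only [pev, G', eval_bnd]
          congr 1; funext o
          cases o with
          | none =>
            simp only [Option.elim, Alg.evalTrm]
            congr 1; funext j
            by_cases hj : j = i
            · subst hj; simp [Alg.evalTrm]
            · simp [hj, Alg.evalTrm]
          | some k => rfl
        have := (h i).2 (K ⊕ Fin (σ.arity f)) inferInstance G'
          (Sum.elim c fun j => (a j).1.1) (Sum.elim c' (S.piecewise b2 a2)) (by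
            rintro (k | j)
            · exact hc k
            · by_cases hj : j ∈ S
              · simp only [Sum.elim_inr, hj, Finset.piecewise_eq_of_mem]
                rw [h1]; exact (b j).2
              · simp only [Sum.elim_inr, hj, not_false_eq_true, Finset.piecewise_eq_of_notMem]
                exact (a j).2) (by
            rw [ev, Function.update_eq_self (f := fun j => (a j).1.1)]
            exact hx)
        rw [ev, ev] at this
        have e1 : Function.update (S.piecewise b2 a2) i (a i).1.2 = S.piecewise b2 a2 := by
          rw [Function.update_eq_iff]
          simp [hi, a2]
        have e2 : Function.update (S.piecewise b2 a2) i (b i).1.2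
            = (insert i S).piecewise b2 a2 := (Finset.piecewise_insert _ _ _ _).symm
        rw [e1, e2] at this
        exact ⟨Q0_trans ih.1 this.1, Q0_trans this.2 ih.2⟩
    have := main Finset.univ
    rw [Finset.piecewise_univ] at this
    exact this

/-- Pullback of `α` along the first projection. -/
def alphaHat {σ : Sig} {B : Alg σ} (α : Congruence B) : Congruence (algOn B α) where
  rel p q := α.rel p.1.1 q.1.1
  iseqv := ⟨fun _ => α.iseqv.refl _, fun h => α.iseqv.symm h, fun h h' => α.iseqv.trans h h'⟩
  compat f a b h := α.compat f _ _ h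

theorem rho_central {σ : Sig} {B : Alg σ} {α : Congruence B} (hα : Centralizes α α ⊥)
    {x y : B.carrier} (hxy : α.rel x y) :
    Centralizes (eta1 B α) (alphaHat α) (rho α x y) := by
  intro m n t a b u v hab huv h
  have hab1 : ∀ i, (a i).1.1 = (b i).1.1 := hab
  have hab2 : ∀ i, α.rel (a i).1.2 (b i).1.2 := fun i =>
    α.iseqv.trans (α.iseqv.symm (a i).2) (by rw [hab1]; exact (b i).2)
  have huv2 : ∀ i, α.rel (u i).1.2 (v i).1.2 := fun i =>
    α.iseqv.trans (α.iseqv.symm (u i).2) (α.iseqv.trans (huv i) (v i).2)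
  have e1 : ∀ w : Fin n → (algOn B α).carrier,
      ((algOn B α).evalTrm (Sum.elim b w) t).1.1 = ((algOn B α).evalTrm (Sum.elim a w) t).1.1 := by
    intro w
    rw [algOn_fst, algOn_fst]
    congr 1; funext i
    rcases i with i | i
    · exact (hab1 i).symm
    · rfl
  obtain ⟨h1, h2⟩ := h
  refine ⟨by rw [e1, e1]; exact h1, fun K hK G c c' hc hx => ?_⟩
  rw [e1] at hx
  have h3 := h2 K hK G c c' hc hx
  let τ : Trm σ ((Fin m ⊕ K) ⊕ Fin n) := G.bnd fun o => o.elim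
    (t.bnd fun w => .var (w.elim (fun i => .inl (.inl i)) (fun j => .inr j)))
    (fun k => .var (.inl (.inr k)))
  have ev : ∀ (a : Fin m → (algOn B α).carrier) (w : Fin n → (algOn B α).carrier),
      pev B G ((algOn B α).evalTrm (Sum.elim a w) t).1.2 c' =
      B.evalTrm (Sum.elim (Sum.elim (fun i => (a i).1.2) c') (fun j => (w j).1.2)) τ := by
    intro a w
    simp only [pev, τ, eval_bnd, algOn_snd]
    congr 1; funext o
    cases o with
    | none =>
      simp only [Option.elim, eval_bnd]
      congr 1; funext i
      cases i <;> rfl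
    | some k => rfl
  have hx1 : α.rel (pev B G ((algOn B α).evalTrm (Sum.elim a u) t).1.2 c') x := by
    rw [← hx]
    apply eval_congr
    intro o
    cases o with
    | none => exact α.iseqv.symm ((algOn B α).evalTrm (Sum.elim a u) t).2
    | some k => exact α.iseqv.symm (hc k)
  have hx2 : α.rel (pev B G ((algOn B α).evalTrm (Sum.elim a v) t).1.2 c') x := by
    rw [h1] at hx
    rw [← hx]
    apply eval_congr
    intro o
    cases o with
    | none => exact α.iseqv.symm ((algOn B α).evalTrm (Sum.elim a v) t).2
    | some k => exact α.iseqv.symm (hc k)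
  rw [ev] at hx1 hx2
  simp only [ev] at h3 ⊢
  have hs : ∀ i, α.rel (Sum.elim (fun i => (a i).1.2) c' i) (Sum.elim (fun i => (b i).1.2) c' i) := by
    rintro (i | i)
    · exact hab2 i
    · exact α.iseqv.refl _
  exact ⟨Q0_central hα hxy τ _ _ _ _ hs huv2 hx2 h3.1,
    Q0_central hα hxy τ _ _ _ _ hs (fun i => α.iseqv.symm (huv2 i)) hx1 h3.2⟩

theorem rho_base {σ : Sig} {B : Alg σ} {α : Congruence B} (hα : Centralizes α α ⊥)
    {x y : B.carrier} (hxy : α.rel x y) (hyx : α.rel y x)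
    (gen : ∀ b, ∃ t : Trm σ (Fin 2), B.evalTrm ![x, y] t = b)
    (generic : ∀ s t : Trm σ (Fin 2), B.evalTrm ![x, y] s = B.evalTrm ![x, y] t →
      ∀ p q, α.rel p q → B.evalTrm ![p, q] s = B.evalTrm ![p, q] t) :
    (rho α x y).rel ⟨(y, x), hyx⟩ ⟨(y, y), α.iseqv.refl y⟩ := by
  refine ⟨rfl, fun K hK G c c' hc hx => ?_⟩
  change pev B G y c = x at hx
  change Q0 α x y (pev B G x c') (pev B G y c') ∧ Q0 α x y (pev B G y c') (pev B G x c')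
  choose g hg using gen
  -- the binary term
  have hid : ∀ p q, α.rel p q →
      pev B G q (fun k => B.evalTrm ![p, q] (g (c k))) = p := by
    have ev : ∀ p q, B.evalTrm ![p, q] (G.bnd fun o => o.elim (.var 1) fun k => g (c k)) =
        pev B G q (fun k => B.evalTrm ![p, q] (g (c k))) := by
      intro p q
      rw [eval_bnd]
      simp only [pev]
      congr 1; funext o
      cases o <;> rfl
    intro p q hpq
    rw [← ev]
    refine generic _ (.var 0) ?_ p q hpq
    rw [ev]
    simp only [hg]
    exact hx
  -- moving parameters
  have mv : ∀ (z z' : B.carrier) (d d' : K → B.carrier), α.rel z z' → (∀ k, α.rel (d k) (d' k)) →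
      pev B G z d = pev B G z d' → pev B G z' d = pev B G z' d' := by
    intro z z' d d' hz hd h
    let τ : Trm σ (Unit ⊕ K) := G.bnd fun o => .var (o.elim (.inl ()) .inr)
    have ev : ∀ (z : B.carrier) d, B.evalTrm (Sum.elim (fun _ => z) d) τ = pev B G z d := by
      intro z d
      simp only [τ, eval_bnd, pev]
      congr 1; funext o
      cases o <;> rfl
    have := central_fin hα τ (fun _ => z) (fun _ => z') d d' (fun _ => hz) hd
    simp only [ev, bot_rel] at this
    exact this h
  have hpar : ∀ p q, α.rel p x → α.rel q y → ∀ k, α.rel (B.evalTrm ![p, q] (g (c k))) (c' k) := by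
    intro p q hp hq k
    have : α.rel (B.evalTrm ![p, q] (g (c k))) (c k) := by
      conv_rhs => rw [← hg (c k)]
      apply eval_congr
      intro i
      fin_cases i
      · exact hp
      · exact hq
    exact α.iseqv.trans this (hc k)
  have hblk : ∀ z, α.rel z y → α.rel (pev B G z c') x := by
    intro z hz
    rw [← hx]
    apply eval_congr
    intro o
    cases o with
    | none => exact hz
    | some k => exact α.iseqv.symm (hc k)
  constructor
  · have ev : ∀ p q r, B.evalTrm ![p, q, r]
        (G.bnd fun o => o.elim (.var 2) fun k => (g (c k)).bnd ![.var 0, .var 1]) =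
        pev B G r (fun k => B.evalTrm ![p, q] (g (c k))) := by
      intro p q r
      rw [eval_bnd]
      simp only [pev]
      congr 1; funext o
      cases o with
      | none => rfl
      | some k =>
        simp only [Option.elim, eval_bnd]
        congr 1; funext i
        fin_cases i <;> rfl
    refine ⟨G.bnd fun o => o.elim (.var 2) fun k => (g (c k)).bnd ![.var 0, .var 1], ?_, ?_⟩
    · intro p q hpq
      rw [ev]; exact hid p q hpq
    · rw [ev]
      have hb := hblk x hxy
      exact mv x y _ _ hxy (hpar _ _ hb hxy) (hid _ _ hb)
  · have ev : ∀ p q r, B.evalTrm ![p, q, r]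
        (G.bnd fun o => o.elim (.var 1) fun k => (g (c k)).bnd ![.var 0, .var 2]) =
        pev B G q (fun k => B.evalTrm ![p, r] (g (c k))) := by
      intro p q r
      rw [eval_bnd]
      simp only [pev]
      congr 1; funext o
      cases o with
      | none => rfl
      | some k =>
        simp only [Option.elim, eval_bnd]
        congr 1; funext i
        fin_cases i <;> rfl
    refine ⟨G.bnd fun o => o.elim (.var 1) fun k => (g (c k)).bnd ![.var 0, .var 2], ?_, ?_⟩
    · intro p q hpq
      rw [ev]; exact hid p q hpq
    · rw [ev]
      have hb := hblk y (α.iseqv.refl y)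
      exact mv y x _ _ hyx (hpar _ _ hb (α.iseqv.refl y))
        (hid _ _ (α.iseqv.trans hb hxy))

theorem core {σ : Sig} (V : Variety σ) (hV : HasTaylorTrm V)
    (hcomm : ∀ A : Alg σ, V.Mem A → ∀ x y : Congruence A, x ≤ y → commC x y = commC y x)
    {B : Alg σ} (hB : V.Mem B) {α : Congruence B} (hα : Centralizes α α ⊥)
    {x y : B.carrier} (hxy : α.rel x y)
    (gen : ∀ b, ∃ t : Trm σ (Fin 2), B.evalTrm ![x, y] t = b)
    (generic : ∀ s t : Trm σ (Fin 2), B.evalTrm ![x, y] s = B.evalTrm ![x, y] t →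
      ∀ p q, α.rel p q → B.evalTrm ![p, q] s = B.evalTrm ![p, q] t) :
    ∃ e : Trm σ (Fin 3), B.evalTrm ![x, y, y] e = x ∧ B.evalTrm ![x, x, y] e = y := by
  have hyx := α.iseqv.symm hxy
  have hc : Centralizes (alphaHat α) (eta1 B α) (rho α x y) := by
    refine central_symm V hcomm (algOn_mem V hB α) (fun p q h => h.1) ?_ (rho_central hα hxy)
    intro p q h
    have h' : p.1.1 = q.1.1 := h
    change α.rel p.1.1 q.1.1
    rw [h']; exact α.iseqv.refl _
  have h := taylor_step V hV hB α x y hxy hyx (alphaHat α) (rho α x y) (fun _ _ h => h) hc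
    (rho_base hα hxy hyx gen generic)
  obtain ⟨⟨e, he, he'⟩, -⟩ := h.2 Empty inferInstance (.var none) Empty.elim Empty.elim
    (fun k => k.elim) rfl
  exact ⟨e, he x y hxy, he'⟩

/-- An abelian pair of `V`. -/
structure AbPair {σ : Sig} (V : Variety σ) where
  A : Alg σ
  mem : V.Mem A
  α : Congruence A
  ab : Centralizes α α ⊥
  a : A.carrier
  b : A.carrier
  rel : α.rel a b

/-- subalgebra generated by two elements -/
def sub2 {σ : Sig} (P : Alg σ) (x y : P.carrier) : Alg σ where
  carrier := {p : P.carrier // ∃ t : Trm σ (Fin 2), P.evalTrm ![x, y] t = p}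
  interp f a := ⟨P.interp f fun i => (a i).1, by
    choose t ht using fun i => (a i).2
    exact ⟨.op f t, by simp only [Alg.evalTrm, ht]⟩⟩

theorem exists_generic {σ : Sig} (V : Variety σ) :
    ∃ (B : Alg σ) (_ : V.Mem B) (α : Congruence B) (_ : Centralizes α α ⊥) (x y : B.carrier)
      (_ : α.rel x y), (∀ b, ∃ t : Trm σ (Fin 2), B.evalTrm ![x, y] t = b) ∧
      ∀ s t : Trm σ (Fin 2), B.evalTrm ![x, y] s = B.evalTrm ![x, y] t →
        ∀ W : AbPair V, W.A.evalTrm ![W.a, W.b] s = W.A.evalTrm ![W.a, W.b] t := by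
  classical
  let I : Type := {st : Trm σ (Fin 2) × Trm σ (Fin 2) //
    ∃ W : AbPair V, W.A.evalTrm ![W.a, W.b] st.1 ≠ W.A.evalTrm ![W.a, W.b] st.2}
  let W : I → AbPair V := fun i => i.2.choose
  have hW : ∀ i : I, (W i).A.evalTrm ![(W i).a, (W i).b] i.1.1 ≠
    (W i).A.evalTrm ![(W i).a, (W i).b] i.1.2 := fun i => i.2.choose_spec
  let P : Alg σ := prodAlg fun i => (W i).A
  let x : P.carrier := fun i => (W i).a
  let y : P.carrier := fun i => (W i).b
  let B := sub2 P x y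
  let inc : UAHom B P := ⟨fun p => p.1, fun _ _ => rfl⟩
  let pr : ∀ i, UAHom B (W i).A := fun i => ⟨fun p => p.1 i, fun _ _ => rfl⟩
  let X : B.carrier := ⟨x, .var 0, rfl⟩
  let Y : B.carrier := ⟨y, .var 1, rfl⟩
  have hext : ∀ p q : B.carrier, (∀ i, (pr i).toFun p = (pr i).toFun q) → p = q :=
    fun p q h => Subtype.ext (funext h)
  let α : Congruence B :=
    { rel := fun p q => ∀ i, (W i).α.rel ((pr i).toFun p) ((pr i).toFun q)
      iseqv := ⟨fun p i => (W i).α.iseqv.refl _, fun h i => (W i).α.iseqv.symm (h i),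
        fun h h' i => (W i).α.iseqv.trans (h i) (h' i)⟩
      compat := fun f a b h i => (W i).α.compat f _ _ fun j => h j i }
  have evc : ∀ (p q : B.carrier) (i : I) (t : Trm σ (Fin 2)),
      (pr i).toFun (B.evalTrm ![p, q] t) =
        (W i).A.evalTrm ![(pr i).toFun p, (pr i).toFun q] t := by
    intro p q i t
    rw [eval_hom]
    congr 1; funext j
    fin_cases j <;> rfl
  refine ⟨B, V.closed_sub (V.closed_prod _ fun i => (W i).mem) ⟨inc, fun p q h => Subtype.ext h⟩,
    α, ?_, X, Y, fun i => (W i).rel, ?_, ?_⟩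
  · intro m n t a b u v hab huv h
    rw [bot_rel] at h ⊢
    apply hext
    intro i
    have := (W i).ab m n t (fun j => (pr i).toFun (a j)) (fun j => (pr i).toFun (b j))
      (fun j => (pr i).toFun (u j)) (fun j => (pr i).toFun (v j)) (fun j => hab j i)
      (fun j => huv j i)
    have e : ∀ (a : Fin m → B.carrier) (u : Fin n → B.carrier),
        (W i).A.evalTrm (Sum.elim (fun j => (pr i).toFun (a j)) (fun j => (pr i).toFun (u j))) t =
        (pr i).toFun (B.evalTrm (Sum.elim a u) t) := by
      intro a u
      rw [eval_hom]
      congr 1; funext j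
      cases j <;> rfl
    simp only [e, bot_rel] at this
    exact this (by rw [h])
  · rintro ⟨p, t, ht⟩
    refine ⟨t, Subtype.ext ?_⟩
    change inc.toFun _ = _
    rw [eval_hom]
    refine Eq.trans ?_ ht
    congr 1; funext j
    fin_cases j <;> rfl
  · intro s t hst U
    by_contra hne
    let i : I := ⟨(s, t), U, hne⟩
    apply hW i
    have := congrArg (pr i).toFun hst
    rw [evc, evc] at this
    exact this

/-- If a variety `V` has a Taylor term and the commutator is commutative on
comparable pairs of congruences throughout `V`, then `V` has a weak difference
term. -/
theorem commutative_implies_weak {σ : Sig} (V : Variety σ)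
    (hT : HasTaylorTrm V)
    (hcomm : ∀ A : Alg σ, V.Mem A → ∀ x y : Congruence A, x ≤ y →
      commC x y = commC y x) :
    ∃ d : Trm σ (Fin 3), IsWeakDifferenceTrm V d := by
  obtain ⟨B, hB, α, hα, x, y, hxy, gen, generic⟩ := exists_generic V
  obtain ⟨e, h1, h2⟩ := core V hT hcomm hB hα hxy gen
    (fun s t h p q hpq => generic s t h ⟨B, hB, α, hα, p, q, hpq⟩)
  have ev : ∀ (A : Alg σ) (p q : A.carrier) (f : Fin 3 → Fin 2),
      A.evalTrm ![p, q] (e.bnd fun i => .var (f i)) = A.evalTrm (fun i => ![p, q] (f i)) e :=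
    fun A p q f => eval_bnd A _ _ e
  have c1 : ∀ (A : Alg σ) (p q : A.carrier), (fun i => ![p, q] (![0, 1, 1] i)) = ![p, q, q] := by
    intro A p q
    funext i
    fin_cases i <;> rfl
  have c2 : ∀ (A : Alg σ) (p q : A.carrier), (fun i => ![p, q] (![0, 0, 1] i)) = ![p, p, q] := by
    intro A p q
    funext i
    fin_cases i <;> rfl
  refine ⟨e, fun A hA β hβ a b hab => ?_⟩
  let W : AbPair V := ⟨A, hA, β, commC_bot.1 hβ, a, b, hab⟩
  have g1 := generic (e.bnd fun i => .var (![0, 1, 1] i)) (.var 0)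
    (by rw [ev, c1]; exact h1) W
  have g2 := generic (e.bnd fun i => .var (![0, 0, 1] i)) (.var 1)
    (by rw [ev, c2]; exact h2) W
  rw [ev, c1] at g1
  rw [ev, c2] at g2
  exact ⟨g2, g1⟩
end

section
/- If a variety V has a Taylor term and does not have a difference term, then V contains an algebra A with congruences forming a pentagon sublattice {0, β, δ, θ, α} of Con(A) (with δ < θ, β ∧ θ = β ∧ δ = 0, β ∨ δ = β ∨ θ = α) satisfying: (1) [α,θ] = 0, (2) C(θ,α;δ) holds, and (3) [α,x]_δ = x for all x in the interval I[δ,θ]. -/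
/-! ### Helper material -/

namespace TND

/-- Substitution of terms for variables. -/
def bnd {σ : Sig} {V W : Type} (g : V → Trm σ W) : Trm σ V → Trm σ W
  | .var v => g v
  | .op f ts => .op f fun i => bnd g (ts i)

theorem eval_bnd {σ : Sig} (A : Alg σ) {V W : Type} (g : V → Trm σ W) (asg : W → A.carrier)
    (t : Trm σ V) : A.evalTrm asg (bnd g t) = A.evalTrm (fun v => A.evalTrm asg (g v)) t := by
  induction t with
  | var v => rfl
  | op f ts ih =>
    simp only [bnd, Alg.evalTrm]
    congr 1
    funext i
    exact ih i

/-- Changing the arguments one at a time. -/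
theorem hybrid {n : ℕ} {X Y : Type} {p : Fin n → X} (Φ : (Fin n → X) → Y) (R : Y → Y → Prop)
    (hr : R (Φ p) (Φ p)) (ht : ∀ a b c, R a b → R b c → R a c) (q : Fin n → X)
    (h : ∀ i (g : Fin n → X), (∀ j, g j = p j ∨ g j = q j) →
      R (Φ (Function.update g i (p i))) (Φ (Function.update g i (q i)))) :
    R (Φ p) (Φ q) := by
  have key : ∀ k : ℕ, k ≤ n → R (Φ p) (Φ (fun j : Fin n => if j.1 < k then q j else p j)) := by
    intro k
    induction k with
    | zero => intro _; simpa using hr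
    | succ k ih =>
      intro hk
      refine ht _ _ _ (ih (by omega)) ?_
      have := h ⟨k, hk⟩ (fun j : Fin n => if j.1 < k then q j else p j)
        (by intro j; split <;> simp)
      convert this using 2
      · funext j
        by_cases hj : j = ⟨k, hk⟩
        · subst hj; simp
        · simp [Function.update_of_ne hj]
      · funext j
        by_cases hj : j = ⟨k, hk⟩
        · subst hj; simp
        · rw [Function.update_of_ne hj]
          have : j.1 ≠ k := fun e => hj (Fin.ext e)
          by_cases h1 : j.1 < k
          · simp [h1, Nat.lt_succ_of_lt h1]
          · have : ¬ j.1 < k + 1 := by omega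
            simp [h1, this]
  have := key n le_rfl
  simpa using this

theorem Cong_eval {σ : Sig} {A : Alg σ} (c : Congruence A) {V : Type} (a b : V → A.carrier)
    (h : ∀ v, c.rel (a v) (b v)) (t : Trm σ V) : c.rel (A.evalTrm a t) (A.evalTrm b t) := by
  induction t with
  | var v => exact h v
  | op f ts ih => exact c.compat f _ _ ih

/-- The equality congruence. -/
def eqC {σ : Sig} (A : Alg σ) : Congruence A where
  rel := Eq
  iseqv := ⟨fun _ => rfl, Eq.symm, Eq.trans⟩
  compat f _ _ h := congrArg (A.interp f) (funext h)

theorem bot_rel {σ : Sig} {A : Alg σ} {a b : A.carrier} (h : (⊥ : Congruence A).rel a b) :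
    a = b := (bot_le : (⊥ : Congruence A) ≤ eqC A) a b h

/-- The relation of `α,α`-matrices. -/
inductive Mat {σ : Sig} {A : Alg σ} (α : Congruence A) :
    A.carrier → A.carrier → A.carrier → A.carrier → Prop
  | refl {p q} : α.rel p q → Mat α p q p q
  | diag {p q} : α.rel p q → Mat α p p q q
  | op (f : σ.ops) (p q r s : Fin (σ.arity f) → A.carrier) :
      (∀ i, Mat α (p i) (q i) (r i) (s i)) →
      Mat α (A.interp f p) (A.interp f q) (A.interp f r) (A.interp f s)

theorem Mat.exists_trm {σ : Sig} {A : Alg σ} {α : Congruence A} {p q r s : A.carrier}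
    (h : Mat α p q r s) : ∃ (m n : ℕ) (t : Trm σ (Sum (Fin m) (Fin n)))
      (a b : Fin m → A.carrier) (u v : Fin n → A.carrier),
      (∀ i, α.rel (a i) (b i)) ∧ (∀ j, α.rel (u j) (v j)) ∧
      A.evalTrm (Sum.elim a u) t = p ∧ A.evalTrm (Sum.elim a v) t = q ∧
      A.evalTrm (Sum.elim b u) t = r ∧ A.evalTrm (Sum.elim b v) t = s := by
  induction h with
  | @refl p q h =>
    exact ⟨0, 1, .var (.inr 0), Fin.elim0, Fin.elim0, fun _ => p, fun _ => q,
      fun i => i.elim0, fun _ => h, rfl, rfl, rfl, rfl⟩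
  | @diag p q h =>
    exact ⟨1, 0, .var (.inl 0), fun _ => p, fun _ => q, Fin.elim0, Fin.elim0,
      fun _ => h, fun i => i.elim0, rfl, rfl, rfl, rfl⟩
  | op f p q r s _ ih =>
    choose m n t a b u v hab huv hp hq hr hs using ih
    let e := Fintype.equivFin (Σ i, Fin (m i))
    let e' := Fintype.equivFin (Σ i, Fin (n i))
    let R : ∀ i, (Fin (m i) ⊕ Fin (n i)) →
        Trm σ (Fin (Fintype.card (Σ i, Fin (m i))) ⊕ Fin (Fintype.card (Σ i, Fin (n i)))) :=
      fun i => Sum.elim (fun j => .var (.inl (e ⟨i, j⟩))) (fun j => .var (.inr (e' ⟨i, j⟩)))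
    have key : ∀ (a : ∀ i, Fin (m i) → A.carrier) (u : ∀ i, Fin (n i) → A.carrier),
        A.evalTrm (Sum.elim (fun k => a (e.symm k).1 (e.symm k).2)
          (fun k => u (e'.symm k).1 (e'.symm k).2)) (.op f fun i => bnd (R i) (t i)) =
        A.interp f fun i => A.evalTrm (Sum.elim (a i) (u i)) (t i) := by
      intro a u
      simp only [Alg.evalTrm, eval_bnd]
      congr 1
      funext i
      congr 1
      funext k
      rcases k with k | k
      · simp only [R, Sum.elim_inl, Alg.evalTrm]
        rw [Equiv.symm_apply_apply]
      · simp only [R, Sum.elim_inr, Alg.evalTrm]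
        rw [Equiv.symm_apply_apply]
    refine ⟨_, _, .op f fun i => bnd (R i) (t i),
      fun k => a (e.symm k).1 (e.symm k).2, fun k => b (e.symm k).1 (e.symm k).2,
      fun k => u (e'.symm k).1 (e'.symm k).2, fun k => v (e'.symm k).1 (e'.symm k).2,
      fun _ => hab _ _, fun _ => huv _ _, ?_, ?_, ?_, ?_⟩
    · rw [key a u]; congr 1; funext i; exact hp i
    · rw [key a v]; congr 1; funext i; exact hq i
    · rw [key b u]; congr 1; funext i; exact hr i
    · rw [key b v]; congr 1; funext i; exact hs i

theorem centralizes_commC {σ : Sig} {A : Alg σ} (S T : Congruence A) :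
    Centralizes S T (commC S T) := by
  intro m n t a b u v hab huv h c hc
  exact hc m n t a b u v hab huv (h c hc)

theorem Mat.diag_of_abelian {σ : Sig} {A : Alg σ} {α : Congruence A} (hα : IsAbelianCong α)
    {p r s : A.carrier} (h : Mat α p p r s) : r = s := by
  obtain ⟨m, n, t, a, b, u, v, hab, huv, h1, h2, h3, h4⟩ := h.exists_trm
  have hc := centralizes_commC α α
  rw [hα] at hc
  rw [← h3, ← h4]
  apply bot_rel
  apply hc m n t a b u v hab huv
  rw [h1, h2]
  exact (⊥ : Congruence A).iseqv.refl _

/-- Good 4-ary relations. -/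
structure Good {σ : Sig} {A : Alg σ} (α : Congruence A)
    (D : A.carrier → A.carrier → A.carrier → A.carrier → Prop) : Prop where
  refl : ∀ {p q}, α.rel p q → D p q p q
  diag : ∀ {p q}, α.rel p q → D p p q q
  op : ∀ (f : σ.ops) (p q r s : Fin (σ.arity f) → A.carrier),
      (∀ i, D (p i) (q i) (r i) (s i)) →
      D (A.interp f p) (A.interp f q) (A.interp f r) (A.interp f s)
  row : ∀ {p q r s}, D p q r s → D r s p q
  col : ∀ {p q r s}, D p q r s → D q p s r
  in1 : ∀ {p q r s}, D p q r s → α.rel p q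
  in2 : ∀ {p q r s}, D p q r s → α.rel p r
  pres : ∀ {p r s}, D p p r s → r = s

theorem Good.eval {σ : Sig} {A : Alg σ} {α : Congruence A}
    {D : A.carrier → A.carrier → A.carrier → A.carrier → Prop} (hD : Good α D)
    {V : Type} (p q r s : V → A.carrier) (h : ∀ v, D (p v) (q v) (r v) (s v)) (t : Trm σ V) :
    D (A.evalTrm p t) (A.evalTrm q t) (A.evalTrm r t) (A.evalTrm s t) := by
  induction t with
  | var v => exact h v
  | op f ts ih => exact hD.op f _ _ _ _ ih

theorem good_mat {σ : Sig} {A : Alg σ} {α : Congruence A}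
    (hpres : ∀ {p r s}, Mat α p p r s → r = s) : Good α (Mat α) where
  refl := .refl
  diag := .diag
  op := .op
  row h := by
    induction h with
    | refl h => exact .refl h
    | diag h => exact .diag (α.iseqv.symm h)
    | op f p q r s _ ih => exact .op f _ _ _ _ ih
  col h := by
    induction h with
    | refl h => exact .refl (α.iseqv.symm h)
    | diag h => exact .diag h
    | op f p q r s _ ih => exact .op f _ _ _ _ ih
  in1 h := by
    induction h with
    | refl h => exact h
    | diag h => exact α.iseqv.refl _
    | op f p q r s _ ih => exact α.compat f _ _ ih
  in2 h := by
    induction h with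
    | refl h => exact α.iseqv.refl _
    | diag h => exact h
    | op f p q r s _ ih => exact α.compat f _ _ ih
  pres := hpres

/-- Cancellation, from the Taylor identities. -/
theorem Good.cancel {σ : Sig} {V : Variety σ} {n : ℕ} {T : Trm σ (Fin n)} (hT : IsTaylorTrm V T)
    {A : Alg σ} (hA : V.Mem A) {α : Congruence A}
    {D : A.carrier → A.carrier → A.carrier → A.carrier → Prop} (hD : Good α D)
    {a b c : A.carrier} (h : D a b a c) : b = c := by
  have hab := hD.in1 h
  have hac := hD.in1 (hD.row h)
  have hbc := α.iseqv.trans (α.iseqv.symm hab) hac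
  have main := hybrid (p := fun _ => b) (fun g => A.evalTrm g T) Eq rfl
    (fun _ _ _ => Eq.trans) (fun _ => c) ?_
  · simpa [hT.2.1 A hA] using main
  intro i g hg
  have step : ∀ w z : Fin n → Bool, w i = true → z i = false →
      (∀ x y : A.carrier,
        A.evalTrm (fun j => cond (w j) x y) T = A.evalTrm (fun j => cond (z j) x y) T) →
      A.evalTrm (Function.update g i b) T = A.evalTrm (Function.update g i c) T := by
    intro w z hw hz hwz
    have h1 := hD.eval (fun j => cond (w j) a b) (fun j => cond (z j) a b)
      (fun j => cond (w j) a b) (Function.update (fun j => cond (z j) a b) i c) (by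
        intro j
        by_cases hj : j = i
        · subst hj; simpa [hw, hz] using h
        · rw [Function.update_of_ne hj]
          apply hD.refl
          cases w j <;> cases z j
          · exact α.iseqv.refl _
          · exact α.iseqv.symm hab
          · exact hab
          · exact α.iseqv.refl _) T
    rw [hwz] at h1
    have h2 := hD.pres h1
    have hz' : (fun j => cond (z j) a b) = Function.update (fun j => cond (z j) a b) i b := by
      funext j
      by_cases hj : j = i
      · subst hj; simp [hz]
      · rw [Function.update_of_ne hj]
    have h3 := hD.eval (Function.update (fun j => cond (z j) a b) i b)
      (Function.update (fun j => cond (z j) a b) i c)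
      (Function.update g i b) (Function.update g i c) (by
        intro j
        by_cases hj : j = i
        · subst hj; simpa using hD.refl hbc
        · simp only [Function.update_of_ne hj]
          apply hD.diag
          rcases hg j with e | e <;> rw [e] <;> cases z j
          · exact α.iseqv.refl _
          · exact hab
          · exact hbc
          · exact hac) T
    rw [← hz', ← h2] at h3
    exact hD.pres h3
  obtain ⟨w, z, hne, hwz⟩ := hT.2.2 i
  cases hw : w i <;> cases hz : z i
  · simp [hw, hz] at hne
  · exact step z w hz hw fun x y => (hwz A hA x y).symm
  · exact step w z hw hz fun x y => hwz A hA x y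
  · simp [hw, hz] at hne

/-- Vertical composition of a 4-ary relation with itself. -/
def vc {X : Type} (D : X → X → X → X → Prop) : X → X → X → X → Prop :=
  fun p q r s => ∃ u v, D p q u v ∧ D u v r s

/-- Transposition. -/
def tr {X : Type} (D : X → X → X → X → Prop) : X → X → X → X → Prop :=
  fun p q r s => D p r q s

theorem Good.vc {σ : Sig} {A : Alg σ} {α : Congruence A}
    {D : A.carrier → A.carrier → A.carrier → A.carrier → Prop} (hD : Good α D) :
    Good α (vc D) where
  refl h := ⟨_, _, hD.refl h, hD.refl h⟩
  diag h := ⟨_, _, hD.diag h, hD.refl (α.iseqv.refl _)⟩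
  op f p q r s h := by
    choose u v h1 h2 using h
    exact ⟨_, _, hD.op f _ _ _ _ h1, hD.op f _ _ _ _ h2⟩
  row := by
    rintro p q r s ⟨u, v, h1, h2⟩
    exact ⟨u, v, hD.row h2, hD.row h1⟩
  col := by
    rintro p q r s ⟨u, v, h1, h2⟩
    exact ⟨v, u, hD.col h1, hD.col h2⟩
  in1 := by
    rintro p q r s ⟨u, v, h1, h2⟩
    exact hD.in1 h1
  in2 := by
    rintro p q r s ⟨u, v, h1, h2⟩
    exact α.iseqv.trans (hD.in2 h1) (hD.in2 h2)
  pres := by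
    rintro p r s ⟨u, v, h1, h2⟩
    have := hD.pres h1
    subst this
    exact hD.pres h2

theorem Good.tr {σ : Sig} {V : Variety σ} {n : ℕ} {T : Trm σ (Fin n)} (hT : IsTaylorTrm V T)
    {A : Alg σ} (hA : V.Mem A) {α : Congruence A}
    {D : A.carrier → A.carrier → A.carrier → A.carrier → Prop} (hD : Good α D) :
    Good α (tr D) where
  refl h := hD.diag h
  diag h := hD.refl h
  op f p q r s h := hD.op f _ _ _ _ h
  row h := hD.col h
  col h := hD.row h
  in1 h := hD.in2 h
  in2 h := hD.in1 h
  pres h := hD.cancel hT hA h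

/-- The stages of the two-sided transitive closure. -/
def stage {σ : Sig} {A : Alg σ} (α : Congruence A) :
    ℕ → A.carrier → A.carrier → A.carrier → A.carrier → Prop
  | 0 => Mat α
  | k + 1 => tr (vc (tr (vc (stage α k))))

/-- The two-sided transitive closure. -/
def Del {σ : Sig} {A : Alg σ} (α : Congruence A) (p q r s : A.carrier) : Prop :=
  ∃ k, stage α k p q r s

theorem del_spec {σ : Sig} {V : Variety σ} {n : ℕ} {T : Trm σ (Fin n)} (hT : IsTaylorTrm V T)
    {A : Alg σ} (hA : V.Mem A) {α : Congruence A}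
    (hpres : ∀ {p r s}, Mat α p p r s → r = s) :
    Good α (Del α) ∧ (∀ p q u v r s, Del α p q u v → Del α u v r s → Del α p q r s) ∧
    (∀ p q u v r s, Del α p u r v → Del α u q v s → Del α p q r s) := by
  have hg : ∀ k, Good α (stage α k) := by
    intro k
    induction k with
    | zero => exact good_mat hpres
    | succ k ih => exact ((ih.vc.tr hT hA).vc).tr hT hA
  have up : ∀ {D : A.carrier → A.carrier → A.carrier → A.carrier → Prop}, Good α D →
      ∀ p q r s, D p q r s → vc D p q r s := fun hD p q r s h =>
    ⟨p, q, hD.refl (hD.in1 h), h⟩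
  have up2 : ∀ k p q r s, vc (stage α k) p q r s → stage α (k + 1) p q r s := by
    intro k p q r s h
    exact up ((hg k).vc.tr hT hA) _ _ _ _ h
  have up1 : ∀ k p q r s, stage α k p q r s → stage α (k + 1) p q r s :=
    fun k p q r s h => up2 _ _ _ _ _ (up (hg k) _ _ _ _ h)
  have mono : ∀ k l, k ≤ l → ∀ p q r s, stage α k p q r s → stage α l p q r s := by
    intro k l hkl
    induction hkl with
    | refl => exact fun _ _ _ _ h => h
    | step _ ih => exact fun p q r s h => up1 _ _ _ _ _ (ih p q r s h)
  refine ⟨⟨fun h => ⟨0, .refl h⟩, fun h => ⟨0, .diag h⟩, ?_, ?_, ?_, ?_, ?_, ?_⟩, ?_, ?_⟩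
  · intro f p q r s h
    choose k hk using h
    refine ⟨Finset.univ.sup k, (hg _).op f _ _ _ _ fun i => ?_⟩
    exact mono _ _ (Finset.le_sup (Finset.mem_univ i)) _ _ _ _ (hk i)
  · rintro p q r s ⟨k, h⟩; exact ⟨k, (hg k).row h⟩
  · rintro p q r s ⟨k, h⟩; exact ⟨k, (hg k).col h⟩
  · rintro p q r s ⟨k, h⟩; exact (hg k).in1 h
  · rintro p q r s ⟨k, h⟩; exact (hg k).in2 h
  · rintro p r s ⟨k, h⟩; exact (hg k).pres h
  · rintro p q u v r s ⟨k, h⟩ ⟨l, h'⟩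
    exact ⟨max k l + 1, up2 _ _ _ _ _ ⟨u, v, mono _ _ (le_max_left _ _) _ _ _ _ h,
      mono _ _ (le_max_right _ _) _ _ _ _ h'⟩⟩
  · rintro p q u v r s ⟨k, h⟩ ⟨l, h'⟩
    exact ⟨max k l + 1, u, v,
      up (hg _) _ _ _ _ (mono _ _ (le_max_left _ _) _ _ _ _ h),
      up (hg _) _ _ _ _ (mono _ _ (le_max_right _ _) _ _ _ _ h')⟩

/-- Assignments on `Bool`. -/
abbrev two {X : Type} (x y : X) : Bool → X := fun b => cond b x y

/-- The first half of being a difference term. -/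
def InD {σ : Sig} (V : Variety σ) (d : Trm σ (Fin 3)) : Prop :=
  ∀ A : Alg σ, V.Mem A → ∀ a b : A.carrier, A.evalTrm ![a, a, b] d = b

/-- The data from which the pentagon is built. -/
structure Ctx (σ : Sig) where
  V : Variety σ
  n : ℕ
  T : Trm σ (Fin n)
  hT : IsTaylorTrm V T
  F : Alg σ
  G : Alg σ
  memF : V.Mem F
  memG : V.Mem G
  x : F.carrier
  y : F.carrier
  X : G.carrier
  Y : G.carrier
  α : Congruence G
  aXY : α.rel X Y
  HF : ∀ s t : Trm σ Bool, F.evalTrm (two x y) s = F.evalTrm (two x y) t →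
    ∀ A : Alg σ, V.Mem A → ∀ a b : A.carrier, A.evalTrm (two a b) s = A.evalTrm (two a b) t
  HG : ∀ s t : Trm σ Bool, α.rel (G.evalTrm (two X Y) s) (G.evalTrm (two X Y) t) →
    ∀ A : Alg σ, V.Mem A → ∀ a : A.carrier, A.evalTrm (two a a) s = A.evalTrm (two a a) t
  pres : ∀ {p r s}, Mat α p p r s → r = s
  hno : ∀ d, InD V d → G.evalTrm ![X, Y, Y] d ≠ X

namespace Ctx

variable {σ : Sig} (c : Ctx σ)

theorem good : Good c.α (Del c.α) := (del_spec c.hT c.memG c.pres).1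

theorem vtrans {p q u v r s} (h : Del c.α p q u v) (h' : Del c.α u v r s) : Del c.α p q r s :=
  (del_spec c.hT c.memG c.pres).2.1 _ _ _ _ _ _ h h'

theorem htrans {p q u v r s} (h : Del c.α p u r v) (h' : Del c.α u q v s) : Del c.α p q r s :=
  (del_spec c.hT c.memG c.pres).2.2 _ _ _ _ _ _ h h'

/-- The algebra of the pentagon. -/
def B : Alg σ where
  carrier := {p : c.F.carrier × c.G.carrier // ∃ s r : Trm σ Bool,
    c.F.evalTrm (two c.x c.y) s = p.1 ∧ c.G.evalTrm (two c.X c.Y) r = p.2 ∧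
    c.α.rel (c.G.evalTrm (two c.X c.Y) s) p.2}
  interp f a := ⟨(c.F.interp f fun i => (a i).1.1, c.G.interp f fun i => (a i).1.2), by
    choose s r h1 h2 h3 using fun i => (a i).2
    refine ⟨.op f s, .op f r, ?_, ?_, ?_⟩
    · simp only [Alg.evalTrm, h1]
    · simp only [Alg.evalTrm, h2]
    · exact c.α.compat f _ _ h3⟩

theorem B_eval1 {W : Type} (asg : W → c.B.carrier) (t : Trm σ W) :
    (c.B.evalTrm asg t).1.1 = c.F.evalTrm (fun w => (asg w).1.1) t := by
  induction t with
  | var v => rfl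
  | op f ts ih =>
    change c.F.interp f (fun i => (c.B.evalTrm asg (ts i)).1.1) = _
    simp only [ih, Alg.evalTrm]

theorem B_eval2 {W : Type} (asg : W → c.B.carrier) (t : Trm σ W) :
    (c.B.evalTrm asg t).1.2 = c.G.evalTrm (fun w => (asg w).1.2) t := by
  induction t with
  | var v => rfl
  | op f ts ih =>
    change c.G.interp f (fun i => (c.B.evalTrm asg (ts i)).1.2) = _
    simp only [ih, Alg.evalTrm]

theorem B_mem : c.V.Mem c.B := by
  have h : c.V.Mem (prodAlg (fun b : Bool => cond b c.F c.G)) :=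
    c.V.closed_prod _ (by intro b; cases b; exacts [c.memG, c.memF])
  refine c.V.closed_sub h ⟨⟨fun p b => match b with
    | true => p.1.1
    | false => p.1.2, ?_⟩, ?_⟩
  · intro f a
    funext b
    cases b <;> rfl
  · intro p q hpq
    apply Subtype.ext
    apply Prod.ext
    · exact congrFun hpq true
    · exact congrFun hpq false

/-- The relation on the fibre over `x`. -/
def J (p q : c.G.carrier) : Prop :=
  ∃ d, InD c.V d ∧ Del c.α c.Y (c.G.evalTrm ![c.X, c.Y, c.Y] d) p q

theorem J_shift {p q r s} (h : c.J p q) (h' : Del c.α p q r s) : c.J r s := by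
  obtain ⟨d, hd, h⟩ := h
  exact ⟨d, hd, c.vtrans h h'⟩

theorem J_refl {p} (h : c.α.rel c.Y p) : c.J p p := by
  refine ⟨.var 2, fun _ _ _ _ => rfl, ?_⟩
  exact c.good.diag h

theorem eval3 {A : Alg σ} {U : Type} (g : Fin 3 → Trm σ U) (asg : U → A.carrier)
    (d : Trm σ (Fin 3)) : A.evalTrm asg (bnd g d) =
    A.evalTrm ![A.evalTrm asg (g 0), A.evalTrm asg (g 1), A.evalTrm asg (g 2)] d := by
  rw [eval_bnd]
  congr 1
  funext i
  fin_cases i <;> rfl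

theorem J_symm {p q} (h : c.J p q) : c.J q p := by
  obtain ⟨d, hd, h⟩ := h
  refine ⟨bnd ![.var 1, .var 0, .var 2] d, ?_, ?_⟩
  · intro A hA a b
    rw [eval3]
    exact hd A hA a b
  · rw [eval3]
    refine c.vtrans ?_ (c.good.col h)
    have h1 := c.good.eval ![c.X, c.X, c.Y] ![c.Y, c.X, c.Y] ![c.X, c.Y, c.Y] ![c.Y, c.Y, c.Y]
      (by
        intro i
        fin_cases i
        · exact c.good.refl c.aXY
        · exact c.good.diag c.aXY
        · exact c.good.diag (c.α.iseqv.refl _)) d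
    rw [hd _ c.memG, hd _ c.memG] at h1
    exact h1

theorem J_trans {p q r} (h : c.J p q) (h' : c.J q r) : c.J p r := by
  obtain ⟨d, hd, h⟩ := h
  obtain ⟨d', hd', h'⟩ := h'
  refine ⟨bnd ![.var 0, .var 1, d] d', ?_, ?_⟩
  · intro A hA a b
    rw [eval3]
    have : A.evalTrm ![a, a, b] d = b := hd A hA a b
    change A.evalTrm ![a, a, A.evalTrm ![a, a, b] d] d' = b
    rw [this]
    exact hd' A hA a b
  · rw [eval3]
    change Del c.α c.Y (c.G.evalTrm ![c.X, c.Y, c.G.evalTrm ![c.X, c.Y, c.Y] d] d') p r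
    set e := c.G.evalTrm ![c.X, c.Y, c.Y] d with he
    have hYe : c.α.rel c.Y e := c.good.in1 h
    have h1 := c.good.eval ![c.Y, c.Y, c.Y] ![c.X, c.Y, c.Y] ![c.Y, c.Y, e] ![c.X, c.Y, e]
      (by
        intro i
        fin_cases i
        · exact c.good.refl (c.α.iseqv.symm c.aXY)
        · exact c.good.diag (c.α.iseqv.refl _)
        · exact c.good.diag hYe) d'
    rw [hd' _ c.memG, hd' _ c.memG] at h1
    exact c.htrans h (c.vtrans (c.good.row h1) h')

theorem J_not : ¬ c.J c.Y c.X := by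
  rintro ⟨d, hd, h⟩
  exact c.hno d hd (c.good.cancel c.hT c.memG h)

theorem fib {P : c.B.carrier} (h : P.1.1 = c.x) : c.α.rel c.Y P.1.2 := by
  obtain ⟨s, r, h1, h2, h3⟩ := P.2
  have := c.HF s (.var true) (by rw [h1, h]; rfl) _ c.memG c.X c.Y
  have e : c.G.evalTrm (two c.X c.Y) s = c.X := this
  rw [e] at h3
  exact c.α.iseqv.trans (c.α.iseqv.symm c.aXY) h3

/-- Assignment for unary polynomials of `B`. -/
def asg (P : c.B.carrier) : Option c.B.carrier → c.B.carrier := fun o => o.elim P id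

/-- The congruence `δ`. -/
def dlt : Congruence c.B where
  rel P Q := P.1.1 = Q.1.1 ∧ ∀ t : Trm σ (Option c.B.carrier),
    (c.B.evalTrm (c.asg P) t).1.1 = c.x →
    c.J (c.B.evalTrm (c.asg P) t).1.2 (c.B.evalTrm (c.asg Q) t).1.2
  iseqv := by
    have aux : ∀ (P Q : c.B.carrier), P.1.1 = Q.1.1 → ∀ t : Trm σ (Option c.B.carrier),
        (c.B.evalTrm (c.asg P) t).1.1 = (c.B.evalTrm (c.asg Q) t).1.1 := by
      intro P Q h t
      rw [B_eval1, B_eval1]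
      congr 1
      funext o
      cases o
      · exact h
      · rfl
    refine ⟨fun P => ⟨rfl, fun t h => c.J_refl (c.fib h)⟩, ?_, ?_⟩
    · rintro P Q ⟨h, h'⟩
      refine ⟨h.symm, fun t ht => c.J_symm (h' t ?_)⟩
      rw [aux P Q h, ht]
    · rintro P Q R ⟨h1, h1'⟩ ⟨h2, h2'⟩
      refine ⟨h1.trans h2, fun t ht => c.J_trans (h1' t ht) (h2' t ?_)⟩
      rw [← aux P Q h1, ht]
  compat f a b h := by
    have h1 : ∀ i, (a i).1.1 = (b i).1.1 := fun i => (h i).1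
    refine ⟨congrArg (c.F.interp f) (funext h1), fun t ht => ?_⟩
    refine hybrid (p := a)
      (fun g => (c.B.evalTrm (c.asg (c.B.interp f g)) t).1.2) c.J (c.J_refl (c.fib ht))
      (fun _ _ _ => c.J_trans) b ?_
    intro i g hg
    let t' : Trm σ (Option c.B.carrier) :=
      bnd (fun o => o.elim (.op f fun j => if j = i then .var none else .var (some (g j)))
        (fun q => .var (some q))) t
    have key : ∀ P, c.B.evalTrm (c.asg P) t' =
        c.B.evalTrm (c.asg (c.B.interp f (Function.update g i P))) t := by
      intro P
      rw [eval_bnd]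
      congr 1
      funext o
      cases o with
      | some q => rfl
      | none =>
        simp only [Option.elim, Alg.evalTrm, asg]
        congr 1
        funext j
        by_cases hj : j = i
        · subst hj; simp [Alg.evalTrm, asg]
        · simp [Alg.evalTrm, asg, hj]
    have := (h i).2 t'
    rw [key, key] at this
    apply this
    refine Eq.trans ?_ ht
    rw [B_eval1, B_eval1]
    congr 1
    funext o
    cases o with
    | some q => rfl
    | none =>
      change c.F.interp f _ = c.F.interp f _
      congr 1
      funext j
      by_cases hj : j = i
      · subst hj; simp
      · rw [Function.update_of_ne hj]
        rcases hg j with e | e <;> rw [e]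
        exact (h1 j).symm

/-- `θ`: kernel of the first projection. -/
def tht : Congruence c.B where
  rel p q := p.1.1 = q.1.1
  iseqv := ⟨fun _ => rfl, Eq.symm, Eq.trans⟩
  compat f a b h := congrArg (c.F.interp f) (funext h)

/-- `β`: kernel of the second projection. -/
def bet : Congruence c.B where
  rel p q := p.1.2 = q.1.2
  iseqv := ⟨fun _ => rfl, Eq.symm, Eq.trans⟩
  compat f a b h := congrArg (c.G.interp f) (funext h)

/-- The top of the pentagon. -/
def alp : Congruence c.B where
  rel p q := c.α.rel p.1.2 q.1.2
  iseqv := ⟨fun _ => c.α.iseqv.refl _, fun h => c.α.iseqv.symm h,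
    fun h h' => c.α.iseqv.trans h h'⟩
  compat f a b h := c.α.compat f _ _ h

theorem tht_le_alp {P Q : c.B.carrier} (h : P.1.1 = Q.1.1) : c.α.rel P.1.2 Q.1.2 := by
  obtain ⟨s, r, h1, h2, h3⟩ := P.2
  obtain ⟨s', r', h1', h2', h3'⟩ := Q.2
  have := c.HF s s' (by rw [h1, h1', h]) _ c.memG c.X c.Y
  rw [this] at h3
  exact c.α.iseqv.trans (c.α.iseqv.symm h3) h3'

/-- The `y,y`-instance of a binary term. -/
def yy (s : Trm σ Bool) : Trm σ Bool := bnd (fun _ => .var false) s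

theorem eval_yy (A : Alg σ) (a b : A.carrier) (s : Trm σ Bool) :
    A.evalTrm (two a b) (yy s) = A.evalTrm (two b b) s := by
  rw [yy, eval_bnd]
  congr 1
  funext o
  cases o <;> rfl

theorem rel_yy (s : Trm σ Bool) :
    c.α.rel (c.G.evalTrm (two c.X c.Y) s) (c.G.evalTrm (two c.X c.Y) (yy s)) := by
  rw [eval_yy]
  apply Cong_eval
  intro o
  cases o
  · exact c.α.iseqv.refl _
  · exact c.aXY

/-- Replace the first coordinate `s(x,y)` by `s(y,y)`. -/
theorem exists_low (P : c.B.carrier) : ∃ s : Trm σ Bool,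
    c.F.evalTrm (two c.x c.y) s = P.1.1 ∧
    ∀ Q : c.B.carrier, c.α.rel P.1.2 Q.1.2 →
    ∃ R : c.B.carrier, R.1.1 = c.F.evalTrm (two c.x c.y) (yy s) ∧ R.1.2 = Q.1.2 := by
  obtain ⟨s, r, h1, h2, h3⟩ := P.2
  refine ⟨s, h1, fun Q hQ => ?_⟩
  obtain ⟨s', r', h1', h2', h3'⟩ := Q.2
  refine ⟨⟨(c.F.evalTrm (two c.x c.y) (yy s), Q.1.2), yy s, r', rfl, h2', ?_⟩, rfl, rfl⟩
  exact c.α.iseqv.trans (c.α.iseqv.symm (c.rel_yy s)) (c.α.iseqv.trans h3 hQ)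

/-- The key lemma, one half. -/
theorem key_half (s : Trm σ Bool) (P : c.B.carrier)
    (hP : P.1.1 = c.F.evalTrm (two c.x c.y) (yy s)) (t : Trm σ (Option c.B.carrier))
    (ht : (c.B.evalTrm (c.asg P) t).1.1 = c.x) (k : Option c.B.carrier → c.G.carrier)
    (hk : k = fun o => o.elim (c.G.evalTrm (two c.Y c.Y) s) (fun q => q.1.2)) :
    c.J (c.G.evalTrm k t) (c.B.evalTrm (c.asg P) t).1.2 := by
  obtain ⟨s', r, h1, h2, h3⟩ := P.2
  choose S R hS hR hSR using fun q : c.B.carrier => q.2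
  have e1 := c.HF s' (yy s) (by rw [h1, hP])
  have hr : c.α.rel (c.G.evalTrm (two c.X c.Y) r) (c.G.evalTrm (two c.X c.Y) s) := by
    have := e1 _ c.memG c.X c.Y
    rw [this] at h3
    rw [h2]
    exact c.α.iseqv.symm (c.α.iseqv.trans (c.rel_yy s) h3)
  have e2 := c.HG r s hr
  have idn : ∀ A : Alg σ, c.V.Mem A → ∀ a b : A.carrier,
      A.evalTrm (fun o => o.elim (A.evalTrm (two a a) s) (fun q => A.evalTrm (two b a) (S q))) t
        = b := by
    intro A hA a b
    have := c.HF (bnd (fun o => o.elim (yy s) S) t) (.var true) (by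
      rw [eval_bnd]
      rw [B_eval1] at ht
      refine Eq.trans ?_ ht
      congr 1
      funext o
      cases o with
      | none => exact hP.symm
      | some q => exact hS q) A hA b a
    rw [eval_bnd] at this
    refine Eq.trans ?_ this
    congr 1
    funext o
    cases o with
    | none => exact (eval_yy A b a s).symm
    | some q => rfl
  let d : Trm σ (Fin 3) := bnd (fun o => o.elim (bnd (two (.var 0) (.var 1)) r)
    (fun q => bnd (two (.var 2) (.var 1)) (S q))) t
  have evd : ∀ (A : Alg σ) (a b e : A.carrier), A.evalTrm ![a, b, e] d =
      A.evalTrm (fun o => o.elim (A.evalTrm (two a b) r) (fun q => A.evalTrm (two e b) (S q))) t := by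
    intro A a b e
    rw [eval_bnd]
    congr 1
    funext o
    cases o with
    | none =>
      simp only [Option.elim]
      rw [eval_bnd]
      congr 1
      funext b
      cases b <;> rfl
    | some q =>
      simp only [Option.elim]
      rw [eval_bnd]
      congr 1
      funext b
      cases b <;> rfl
  refine ⟨d, ?_, ?_⟩
  · intro A hA a b
    rw [evd, e2 A hA]
    exact idn A hA a b
  · rw [evd, B_eval2]
    have hY := idn c.G c.memG c.Y c.Y
    have h := c.good.eval
      (fun o => o.elim (c.G.evalTrm (two c.Y c.Y) s) (fun q => c.G.evalTrm (two c.Y c.Y) (S q)))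
      (fun o => o.elim (c.G.evalTrm (two c.X c.Y) r) (fun q => c.G.evalTrm (two c.Y c.Y) (S q)))
      k (fun o => (c.asg P o).1.2) (by
        intro o
        cases o with
        | none =>
          rw [hk]
          simp only [Option.elim, asg]
          rw [h2]
          apply c.good.refl
          have := c.rel_yy s
          rw [eval_yy] at this
          rw [← h2]
          exact c.α.iseqv.symm (c.α.iseqv.trans hr this)
        | some q =>
          rw [hk]
          simp only [Option.elim, asg]
          apply c.good.diag
          have := c.rel_yy (S q)
          rw [eval_yy] at this
          exact c.α.iseqv.trans (c.α.iseqv.symm this) (hSR q)) t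
    rw [hY] at h
    exact h

theorem key (s : Trm σ Bool) (P Q : c.B.carrier)
    (hP : P.1.1 = c.F.evalTrm (two c.x c.y) (yy s))
    (hQ : Q.1.1 = c.F.evalTrm (two c.x c.y) (yy s)) : c.dlt.rel P Q := by
  refine ⟨hP.trans hQ.symm, fun t ht => ?_⟩
  have ht' : (c.B.evalTrm (c.asg Q) t).1.1 = c.x := by
    refine Eq.trans ?_ ht
    rw [B_eval1, B_eval1]
    congr 1
    funext o
    cases o
    · exact hQ.trans hP.symm
    · rfl
  exact c.J_trans (c.J_symm (c.key_half s P hP t ht _ rfl)) (c.key_half s Q hQ t ht' _ rfl)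

theorem dlt_le_tht : c.dlt ≤ c.tht := fun _ _ h => h.1

theorem dlt_lt_tht : c.dlt < c.tht := by
  refine lt_of_le_of_ne c.dlt_le_tht fun e => ?_
  let P : c.B.carrier := ⟨(c.x, c.Y), .var true, .var false, rfl, rfl, c.aXY⟩
  let Q : c.B.carrier := ⟨(c.x, c.X), .var true, .var true, rfl, rfl, c.α.iseqv.refl _⟩
  have h : c.tht.rel P Q := rfl
  rw [← e] at h
  exact c.J_not (h.2 (.var none) rfl)

theorem bet_inf_tht : c.bet ⊓ c.tht = ⊥ := by
  rw [eq_bot_iff]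
  intro P Q h
  have h1 : P.1.2 = Q.1.2 := (inf_le_left : c.bet ⊓ c.tht ≤ c.bet) P Q h
  have h2 : P.1.1 = Q.1.1 := (inf_le_right : c.bet ⊓ c.tht ≤ c.tht) P Q h
  have : P = Q := Subtype.ext (Prod.ext h2 h1)
  rw [this]
  exact (⊥ : Congruence c.B).iseqv.refl _

theorem alp_le : c.alp ≤ c.bet ⊔ c.dlt := by
  intro P Q h
  obtain ⟨s, hs, H⟩ := c.exists_low P
  obtain ⟨R, hR1, hR2⟩ := H P (c.α.iseqv.refl _)
  obtain ⟨R', hR1', hR2'⟩ := H Q h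
  have hb : c.bet ≤ c.bet ⊔ c.dlt := le_sup_left
  have hd : c.dlt ≤ c.bet ⊔ c.dlt := le_sup_right
  refine (c.bet ⊔ c.dlt).iseqv.trans (hb P R hR2.symm) ?_
  refine (c.bet ⊔ c.dlt).iseqv.trans (hd R R' (c.key s R R' hR1 hR1')) ?_
  exact hb R' Q hR2'

theorem pentagon : IsPentagon ⊥ c.bet c.dlt c.tht c.alp := by
  have hb : c.bet ≤ c.alp := fun P Q (h : P.1.2 = Q.1.2) => by
    change c.α.rel _ _
    rw [h]
    exact c.α.iseqv.refl _
  have ht : c.tht ≤ c.alp := fun P Q h => c.tht_le_alp h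
  refine ⟨c.dlt_lt_tht, c.bet_inf_tht, ?_, ?_, ?_⟩
  · rw [eq_bot_iff, ← c.bet_inf_tht]
    exact inf_le_inf_left _ c.dlt_le_tht
  · exact le_antisymm (sup_le hb (c.dlt_le_tht.trans ht)) c.alp_le
  · exact le_antisymm (sup_le hb ht) (c.alp_le.trans (sup_le_sup_left c.dlt_le_tht _))

theorem comm_bot : commC c.alp c.tht = ⊥ := by
  rw [eq_bot_iff]
  intro P Q h
  refine h ⊥ ?_
  intro m n t a b u v hab huv h
  have h := bot_rel h
  have : c.B.evalTrm (Sum.elim b u) t = c.B.evalTrm (Sum.elim b v) t := by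
    apply Subtype.ext
    apply Prod.ext
    · rw [B_eval1, B_eval1]
      congr 1
      funext o
      cases o with
      | inl i => rfl
      | inr j => exact huv j
    · have h2 : (c.B.evalTrm (Sum.elim a u) t).1.2 = (c.B.evalTrm (Sum.elim a v) t).1.2 := by
        rw [h]
      rw [B_eval2, B_eval2] at h2 ⊢
      have := c.good.eval (fun o => (Sum.elim a u o).1.2) (fun o => (Sum.elim a v o).1.2)
        (fun o => (Sum.elim b u o).1.2) (fun o => (Sum.elim b v o).1.2) (by
          intro o
          cases o with
          | inl i => exact c.good.diag (hab i)
          | inr j => exact c.good.refl (c.tht_le_alp (huv j))) t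
      rw [h2] at this
      exact c.good.pres this
  rw [this]
  exact (⊥ : Congruence c.B).iseqv.refl _

theorem cent : Centralizes c.tht c.alp c.dlt := by
  rintro m n t a b u v hab huv ⟨h1, h2⟩
  have hh : ∀ w, (c.B.evalTrm (Sum.elim b w) t).1.1 = (c.B.evalTrm (Sum.elim a w) t).1.1 := by
    intro w
    rw [B_eval1, B_eval1]
    congr 1
    funext o
    cases o with
    | inl i => exact (hab i).symm
    | inr j => rfl
  refine ⟨by rw [hh, hh, h1], fun t' ht' => ?_⟩
  have ht : (c.B.evalTrm (c.asg (c.B.evalTrm (Sum.elim a u) t)) t').1.1 = c.x := by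
    refine Eq.trans ?_ ht'
    rw [B_eval1, B_eval1]
    congr 1
    funext o
    cases o with
    | none => exact (hh u).symm
    | some q => rfl
  refine c.J_shift (h2 t' ht) ?_
  rw [B_eval2, B_eval2, B_eval2, B_eval2]
  apply c.good.eval
  intro o
  cases o with
  | some q => exact c.good.diag (c.α.iseqv.refl _)
  | none =>
    change Del c.α (c.B.evalTrm _ t).1.2 (c.B.evalTrm _ t).1.2 (c.B.evalTrm _ t).1.2
      (c.B.evalTrm _ t).1.2
    rw [B_eval2, B_eval2, B_eval2, B_eval2]
    apply c.good.eval
    intro o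
    cases o with
    | inl i => exact c.good.diag (c.tht_le_alp (hab i))
    | inr j => exact c.good.refl (huv j)

/-- One Taylor place. -/
theorem place (P Q : c.B.carrier) (h : P.1.1 = Q.1.1) (i : Fin c.n) :
    ∃ a : Fin c.n → c.B.carrier, (∀ j, c.alp.rel (a j) P) ∧
      c.dlt.rel (c.B.evalTrm (Function.update a i P) c.T)
        (c.B.evalTrm (Function.update a i Q) c.T) := by
  obtain ⟨s, hs, H⟩ := c.exists_low P
  obtain ⟨P0, hP1, hP2⟩ := H P (c.α.iseqv.refl _)
  obtain ⟨Q0, hQ1, hQ2⟩ := H Q (c.tht_le_alp h)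
  have step : ∀ w z : Fin c.n → Bool, w i = false → z i = true →
      (∀ x y : c.F.carrier, c.F.evalTrm (fun j => cond (w j) x y) c.T =
        c.F.evalTrm (fun j => cond (z j) x y) c.T) →
      ∃ a : Fin c.n → c.B.carrier, (∀ j, c.alp.rel (a j) P) ∧
      c.dlt.rel (c.B.evalTrm (Function.update a i P) c.T)
        (c.B.evalTrm (Function.update a i Q) c.T) := by
    intro w z hw hz hwz
    have snd : ∀ b : Bool, (cond b P P0).1.2 = P.1.2 := by
      intro b; cases b
      · exact hP2
      · rfl
    refine ⟨fun j => cond (z j) P P0, fun j => ?_, ?_, fun t ht => ?_⟩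
    · change c.α.rel _ _
      rw [snd]
      exact c.α.iseqv.refl _
    · rw [B_eval1, B_eval1]
      congr 1
      funext j
      by_cases hj : j = i
      · subst hj; simpa using h
      · simp only [Function.update_of_ne hj]
    · let t' : Trm σ (Option c.B.carrier) :=
        bnd (fun o => o.elim (bnd (fun j => if j = i then .var none
          else .var (some (cond (w j) P P0))) c.T) (fun q => .var (some q))) t
      have key : ∀ R, c.B.evalTrm (c.asg R) t' = c.B.evalTrm (c.asg (c.B.evalTrm
          (Function.update (fun j => cond (w j) P P0) i R) c.T)) t := by
        intro R
        rw [eval_bnd]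
        congr 1
        funext o
        cases o with
        | some q => rfl
        | none =>
          simp only [Option.elim, asg]
          rw [eval_bnd]
          congr 1
          funext j
          by_cases hj : j = i
          · subst hj; simp [Alg.evalTrm, asg]
          · simp [Alg.evalTrm, asg, hj]
      have key2 : ∀ R R0 : c.B.carrier, R0.1.2 = R.1.2 → (c.B.evalTrm (c.asg R0) t').1.2 =
          (c.B.evalTrm (c.asg (c.B.evalTrm
          (Function.update (fun j => cond (z j) P P0) i R) c.T)) t).1.2 := by
        intro R R0 hR
        rw [key, B_eval2, B_eval2]
        congr 1
        funext o
        cases o with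
        | some q => rfl
        | none =>
          change (c.B.evalTrm _ c.T).1.2 = (c.B.evalTrm _ c.T).1.2
          rw [B_eval2, B_eval2]
          congr 1
          funext j
          by_cases hj : j = i
          · subst hj; simpa using hR
          · simp only [Function.update_of_ne hj, snd]
      have hkey := (c.key s P0 Q0 hP1 hQ1).2 t'
      rw [key2 P P0 hP2, key2 Q Q0 hQ2] at hkey
      apply hkey
      rw [key]
      refine Eq.trans ?_ ht
      rw [B_eval1, B_eval1]
      congr 1
      funext o
      cases o with
      | some q => rfl
      | none =>
        change (c.B.evalTrm _ c.T).1.1 = (c.B.evalTrm _ c.T).1.1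
        rw [B_eval1, B_eval1]
        have := hwz P.1.1 P0.1.1
        convert this using 2
        · funext j
          by_cases hj : j = i
          · subst hj; simp [hw]
          · simp only [Function.update_of_ne hj]
            cases w j <;> rfl
        · funext j
          by_cases hj : j = i
          · subst hj; simp [hz]
          · simp only [Function.update_of_ne hj]
            cases z j <;> rfl
  obtain ⟨w, z, hne, hwz⟩ := c.hT.2.2 i
  cases hw : w i <;> cases hz : z i
  · simp [hw, hz] at hne
  · exact step w z hw hz fun x y => hwz _ c.memF x y
  · exact step z w hz hw fun x y => (hwz _ c.memF x y).symm
  · simp [hw, hz] at hne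

theorem rel_comm (ξ : Congruence c.B) (h1 : c.dlt ≤ ξ) (h2 : ξ ≤ c.tht) :
    relCommC c.alp ξ c.dlt = ξ := by
  apply le_antisymm
  · intro P Q h
    refine h ξ ⟨h1, ?_⟩
    intro m n t a b u v hab huv _
    apply Cong_eval
    intro o
    cases o with
    | inl i => exact ξ.iseqv.refl _
    | inr j => exact huv j
  · rintro P Q hPQ γ ⟨hγ, hC⟩
    have hPQ1 : P.1.1 = Q.1.1 := h2 _ _ hPQ
    have main := hybrid (p := fun _ => P) (fun g => c.B.evalTrm g c.T) γ.rel (γ.iseqv.refl _)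
      (fun _ _ _ => γ.iseqv.trans) (fun _ => Q) ?_
    · simpa [c.hT.2.1 c.B c.B_mem] using main
    intro i g hg
    obtain ⟨a, ha, hd⟩ := c.place P Q hPQ1 i
    let t : Trm σ (Fin c.n ⊕ Fin 1) :=
      bnd (fun j => if j = i then .var (.inr 0) else .var (.inl j)) c.T
    have key : ∀ (a : Fin c.n → c.B.carrier) (R : c.B.carrier),
        c.B.evalTrm (Sum.elim a (fun _ => R)) t = c.B.evalTrm (Function.update a i R) c.T := by
      intro a R
      rw [eval_bnd]
      congr 1
      funext j
      by_cases hj : j = i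
      · subst hj; simp [Alg.evalTrm]
      · simp [Alg.evalTrm, hj]
    have := hC c.n 1 t a g (fun _ => P) (fun _ => Q) (by
      intro j
      refine c.alp.iseqv.trans (ha j) ?_
      rcases hg j with e | e <;> rw [e]
      · exact c.alp.iseqv.refl _
      · exact c.tht_le_alp hPQ1) (fun _ => hPQ)
    rw [key, key, key, key] at this
    exact this (hγ _ _ hd)

end Ctx

theorem prod_eval {σ : Sig} {I : Type} (F : I → Alg σ) {W : Type}
    (asg : W → (prodAlg F).carrier) (t : Trm σ W) (i : I) :
    (prodAlg F).evalTrm asg t i = (F i).evalTrm (fun w => asg w i) t := by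
  induction t with
  | var v => rfl
  | op f ts ih =>
    change (F i).interp f (fun j => (prodAlg F).evalTrm asg (ts j) i) = _
    simp only [ih, Alg.evalTrm]

/-- The product congruence. -/
def prodC {σ : Sig} {I : Type} {F : I → Alg σ} (α : ∀ i, Congruence (F i)) :
    Congruence (prodAlg F) where
  rel p q := ∀ i, (α i).rel (p i) (q i)
  iseqv := ⟨fun p i => (α i).iseqv.refl _, fun h i => (α i).iseqv.symm (h i),
    fun h h' i => (α i).iseqv.trans (h i) (h' i)⟩
  compat f a b h i := (α i).compat f _ _ fun j => h j i

theorem prodC_mat {σ : Sig} {I : Type} {F : I → Alg σ} (α : ∀ i, Congruence (F i))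
    {p q r s : (prodAlg F).carrier} (h : Mat (prodC α) p q r s) (i : I) :
    Mat (α i) (p i) (q i) (r i) (s i) := by
  induction h with
  | refl h => exact .refl (h i)
  | diag h => exact .diag (h i)
  | op f p q r s _ ih =>
    exact .op f (fun j => p j i) (fun j => q j i) (fun j => r j i) (fun j => s j i) ih

theorem mat_eqC {σ : Sig} {A : Alg σ} {p q r s : A.carrier} (h : Mat (eqC A) p q r s) :
    r = s := by
  induction h with
  | refl h => exact h
  | diag h => rfl
  | op f p q r s _ ih => exact congrArg _ (funext ih)

/-- A two-generated free algebra inside the variety. -/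
theorem exists_free {σ : Sig} (V : Variety σ) : ∃ (F : Alg σ) (x y : F.carrier), V.Mem F ∧
    ∀ s t : Trm σ Bool, F.evalTrm (two x y) s = F.evalTrm (two x y) t →
    ∀ A : Alg σ, V.Mem A → ∀ a b : A.carrier, A.evalTrm (two a b) s = A.evalTrm (two a b) t := by
  classical
  let I := {st : Trm σ Bool × Trm σ Bool // ∃ A : Alg σ, V.Mem A ∧ ∃ a b : A.carrier,
    A.evalTrm (two a b) st.1 ≠ A.evalTrm (two a b) st.2}
  choose A hA a b hab using fun i : I => i.2
  refine ⟨prodAlg A, a, b, V.closed_prod A hA, ?_⟩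
  intro s t hst A' hA' a' b'
  by_contra hne
  let i : I := ⟨(s, t), A', hA', a', b', hne⟩
  apply hab i
  have := congrFun hst i
  rw [prod_eval, prod_eval] at this
  convert this using 2 <;> (funext o; cases o <;> rfl)

theorem exists_ctx {σ : Sig} (V : Variety σ) (hT : HasTaylorTrm V)
    (hnd : ¬ ∃ d : Trm σ (Fin 3), IsDifferenceTrm V d) : ∃ c : Ctx σ, c.V = V := by
  classical
  obtain ⟨n, T, hT⟩ := hT
  obtain ⟨F, x, y, memF, HF⟩ := exists_free V
  have hw : ∀ d : {d // InD V d}, ∃ A : Alg σ, V.Mem A ∧ ∃ α : Congruence A, IsAbelianCong α ∧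
      ∃ a b, α.rel a b ∧ A.evalTrm ![a, b, b] d.1 ≠ a := by
    intro d
    by_contra hcon
    push Not at hcon
    exact hnd ⟨d.1, d.2, hcon⟩
  choose A hA α hα a b hab hne using hw
  let GF : Option {d // InD V d} → Alg σ := fun o => match o with
    | none => F
    | some d => A d
  let X : (prodAlg GF).carrier := fun o => match o with
    | none => y
    | some d => a d
  let Y : (prodAlg GF).carrier := fun o => match o with
    | none => y
    | some d => b d
  let αs : ∀ o, Congruence (GF o) := fun o => match o with
    | none => eqC F
    | some d => α d
  refine ⟨⟨V, n, T, hT, F, prodAlg GF, memF, ?_, x, y, X, Y, prodC αs, ?_, HF, ?_, ?_, ?_⟩, rfl⟩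
  · apply V.closed_prod
    intro o
    cases o
    · exact memF
    · exact hA _
  · intro o
    cases o with
    | none => exact rfl
    | some d => exact hab d
  · intro s t hst A' hA' a'
    have h0 : (prodAlg GF).evalTrm (two X Y) s none = (prodAlg GF).evalTrm (two X Y) t none :=
      hst none
    rw [prod_eval, prod_eval] at h0
    have h1 := HF (Ctx.yy s) (Ctx.yy t) (by
      rw [Ctx.eval_yy, Ctx.eval_yy]
      convert h0 using 2 <;> (funext o; cases o <;> rfl)) A' hA' a' a'
    rwa [Ctx.eval_yy, Ctx.eval_yy] at h1
  · intro p r s h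
    funext o
    have := prodC_mat αs h o
    cases o with
    | none => exact mat_eqC this
    | some d => exact Mat.diag_of_abelian (hα d) this
  · intro d hd h
    apply hne ⟨d, hd⟩
    have h0 := congrFun h (some ⟨d, hd⟩)
    rw [prod_eval] at h0
    refine Eq.trans ?_ h0
    change (A ⟨d, hd⟩).evalTrm _ d = (A ⟨d, hd⟩).evalTrm _ d
    congr 1
    funext i
    fin_cases i <;> rfl

end TND

/-- If a variety `V` has a Taylor term but no difference term, then `V`
contains an algebra with a pentagon `{0, β, δ, θ, α}` in its congruence
lattice satisfying `[α,θ] = 0`, `C(θ,α;δ)`, and `[α,x]_δ = x` for all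
`x ∈ I[δ,θ]`. -/
theorem taylor_no_difference_pentagon {σ : Sig} (V : Variety σ)
    (hT : HasTaylorTrm V)
    (hnd : ¬ ∃ d : Trm σ (Fin 3), IsDifferenceTrm V d) :
    ∃ A : Alg σ, V.Mem A ∧ ∃ β δ θ α : Congruence A,
      IsPentagon ⊥ β δ θ α ∧
      commC α θ = ⊥ ∧
      Centralizes θ α δ ∧
      ∀ x : Congruence A, δ ≤ x → x ≤ θ → relCommC α x δ = x := by
  obtain ⟨c, rfl⟩ := TND.exists_ctx V hT hnd
  exact ⟨c.B, c.B_mem, c.bet, c.dlt, c.tht, c.alp, c.pentagon, c.comm_bot, c.cent, c.rel_comm⟩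
end

section
/- If a variety V has a weak difference term and the commutator is commutative on pairs of comparable congruences (that is, whenever x ≤ y in Con(A) for A ∈ V, [x,y] = [y,x]), then V has a difference term. -/
/-! ### Auxiliary material -/

namespace CPW

variable {σ : Sig}

theorem bot_rel {A : Alg σ} {a b : A.carrier} :
    (⊥ : Congruence A).rel a b ↔ a = b := by
  constructor
  · intro h
    let c : Congruence A :=
      { rel := Eq
        iseqv := ⟨fun _ => rfl, Eq.symm, Eq.trans⟩
        compat := fun f a b h => congrArg (A.interp f) (funext h) }
    have hc : (⊥ : Congruence A) ≤ c := bot_le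
    exact hc a b h
  · rintro rfl
    exact (⊥ : Congruence A).iseqv.refl a

theorem centralizes_commC {A : Alg σ} (S T : Congruence A) : Centralizes S T (commC S T) := by
  intro m n t a b u v hab huv h c hc
  exact hc m n t a b u v hab huv (h c hc)

theorem commC_eq_bot {A : Alg σ} {S T : Congruence A} :
    commC S T = ⊥ ↔ Centralizes S T ⊥ := by
  constructor
  · intro h
    rw [← h]
    exact centralizes_commC S T
  · intro h
    apply le_antisymm _ bot_le
    intro a b hab
    exact hab ⊥ h

theorem rel_eval {A : Alg σ} (c : Congruence A) {W : Type} (t : Trm σ W)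
    (a b : W → A.carrier) (h : ∀ i, c.rel (a i) (b i)) :
    c.rel (A.evalTrm a t) (A.evalTrm b t) := by
  induction t with
  | var v => exact h v
  | op f ts ih => exact c.compat f _ _ ih

theorem hom_eval {A B : Alg σ} (h : UAHom A B) {W : Type} (t : Trm σ W) (a : W → A.carrier) :
    h.toFun (A.evalTrm a t) = B.evalTrm (fun i => h.toFun (a i)) t := by
  induction t with
  | var v => rfl
  | op f ts ih =>
    simp only [Alg.evalTrm]
    rw [h.map_op]
    congr 1
    funext i
    exact ih i

/-- The term algebra. -/
abbrev termAlg (σ : Sig) (W : Type) : Alg σ where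
  carrier := Trm σ W
  interp f a := Trm.op f a

/-- Evaluation as a homomorphism from the term algebra. -/
def evalHom (A : Alg σ) {W : Type} (asg : W → A.carrier) : UAHom (termAlg σ W) A where
  toFun := A.evalTrm asg
  map_op _ _ := rfl

theorem eval_subst (A : Alg σ) {W U : Type} (asg : W → A.carrier)
    (s : U → Trm σ W) (t : Trm σ U) :
    A.evalTrm asg ((termAlg σ W).evalTrm s t) = A.evalTrm (fun i => A.evalTrm asg (s i)) t :=
  hom_eval (evalHom A asg) t s

/-- The quotient homomorphism. -/
noncomputable def mkHom (A : Alg σ) (c : Congruence A) : UAHom A (quotAlg A c) where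
  toFun := Quotient.mk c.setoid
  map_op f a := by
    apply Quotient.sound
    apply c.compat
    intro i
    exact c.iseqv.symm (Quotient.exact (Quotient.out_eq (Quotient.mk c.setoid (a i))))

theorem mk_eq {A : Alg σ} (c : Congruence A) {a b : A.carrier} :
    (mkHom A c).toFun a = (mkHom A c).toFun b ↔ c.rel a b :=
  ⟨fun h => Quotient.exact h, fun h => Quotient.sound h⟩

theorem mk_surj {A : Alg σ} (c : Congruence A) : Function.Surjective (mkHom A c).toFun :=
  Quotient.mk_surjective

/-- A congruence pushed down to a quotient. -/
noncomputable def quotCong {A : Alg σ} (c S : Congruence A) (h : c ≤ S) :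
    Congruence (quotAlg A c) where
  rel := Quotient.lift₂ (fun a b => S.rel a b) (by
    intro a b a' b' h1 h2
    exact propext ⟨fun k => S.iseqv.trans (S.iseqv.symm (h _ _ h1)) (S.iseqv.trans k (h _ _ h2)),
      fun k => S.iseqv.trans (h _ _ h1) (S.iseqv.trans k (S.iseqv.symm (h _ _ h2)))⟩)
  iseqv := by
    refine ⟨?_, ?_, ?_⟩
    · rintro ⟨a⟩
      exact S.iseqv.refl a
    · rintro ⟨a⟩ ⟨b⟩ k
      exact S.iseqv.symm k
    · rintro ⟨a⟩ ⟨b⟩ ⟨e⟩ k l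
      exact S.iseqv.trans k l
  compat := by
    intro f a b k
    apply S.compat
    intro i
    have := k i
    rw [← Quotient.out_eq (a i), ← Quotient.out_eq (b i)] at this
    exact this

theorem quotCong_rel {A : Alg σ} (c S : Congruence A) (h : c ≤ S) (a b : A.carrier) :
    (quotCong c S h).rel ((mkHom A c).toFun a) ((mkHom A c).toFun b) ↔ S.rel a b := Iff.rfl

theorem centralizes_quot {A : Alg σ} (c S T : Congruence A) (hS : c ≤ S) (hT : c ≤ T) :
    Centralizes (quotCong c S hS) (quotCong c T hT) ⊥ ↔ Centralizes S T c := by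
  have key : ∀ (m n : ℕ) (t : Trm σ (Sum (Fin m) (Fin n))) (a : Fin m → A.carrier)
      (u : Fin n → A.carrier), (quotAlg A c).evalTrm
        (Sum.elim (fun i => (mkHom A c).toFun (a i)) (fun i => (mkHom A c).toFun (u i))) t
        = (mkHom A c).toFun (A.evalTrm (Sum.elim a u) t) := by
    intro m n t a u
    rw [hom_eval]
    congr 1
    funext i
    rcases i with i | i <;> rfl
  constructor
  · intro H m n t a b u v hab huv h
    have := H m n t (fun i => (mkHom A c).toFun (a i)) (fun i => (mkHom A c).toFun (b i))
      (fun i => (mkHom A c).toFun (u i)) (fun i => (mkHom A c).toFun (v i)) hab huv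
    rw [key, key, key, key, bot_rel, bot_rel, mk_eq, mk_eq] at this
    exact this h
  · intro H m n t a b u v hab huv
    obtain ⟨a, rfl⟩ : ∃ a' : Fin m → A.carrier, a = fun i => (mkHom A c).toFun (a' i) :=
      ⟨fun i => (a i).out, funext fun i => (Quotient.out_eq (a i)).symm⟩
    obtain ⟨b, rfl⟩ : ∃ a' : Fin m → A.carrier, b = fun i => (mkHom A c).toFun (a' i) :=
      ⟨fun i => (b i).out, funext fun i => (Quotient.out_eq (b i)).symm⟩
    obtain ⟨u, rfl⟩ : ∃ a' : Fin n → A.carrier, u = fun i => (mkHom A c).toFun (a' i) :=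
      ⟨fun i => (u i).out, funext fun i => (Quotient.out_eq (u i)).symm⟩
    obtain ⟨v, rfl⟩ : ∃ a' : Fin n → A.carrier, v = fun i => (mkHom A c).toFun (a' i) :=
      ⟨fun i => (v i).out, funext fun i => (Quotient.out_eq (v i)).symm⟩
    rw [key, key, key, key, bot_rel, bot_rel, mk_eq, mk_eq]
    exact H m n t a b u v hab huv

/-- Commutativity for comparable congruences, relative to a congruence whose
quotient is in the variety. -/
theorem centralizes_swap (V : Variety σ)
    (hcomm : ∀ A : Alg σ, V.Mem A → ∀ x y : Congruence A, x ≤ y → commC x y = commC y x)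
    {A : Alg σ} (c S T : Congruence A) (hm : V.Mem (quotAlg A c)) (hS : c ≤ S) (hST : S ≤ T) :
    Centralizes S T c ↔ Centralizes T S c := by
  have hT := le_trans hS hST
  have hle : quotCong c S hS ≤ quotCong c T hT := by
    rintro ⟨a⟩ ⟨b⟩ h
    exact hST a b h
  rw [← centralizes_quot c S T hS hT, ← centralizes_quot c T S hT hS, ← commC_eq_bot,
    ← commC_eq_bot, hcomm _ hm _ _ hle]

/-- The weak difference term equations relative to a congruence whose quotient is
in the variety. -/
theorem wdt_quot (V : Variety σ) (d : Trm σ (Fin 3)) (hd : IsWeakDifferenceTrm V d)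
    {A : Alg σ} (c S : Congruence A) (hm : V.Mem (quotAlg A c)) (hS : c ≤ S)
    (hab : Centralizes S S c) (a b : A.carrier) (h : S.rel a b) :
    c.rel (A.evalTrm ![a, a, b] d) b ∧ c.rel (A.evalTrm ![a, b, b] d) a := by
  have h1 := hd _ hm (quotCong c S hS) (commC_eq_bot.2 ((centralizes_quot c S S hS hS).2 hab))
    ((mkHom A c).toFun a) ((mkHom A c).toFun b) h
  rw [← mk_eq c, ← mk_eq c, hom_eval, hom_eval]
  have e : ∀ x y z : A.carrier, (fun i => (mkHom A c).toFun (![x, y, z] i))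
      = ![(mkHom A c).toFun x, (mkHom A c).toFun y, (mkHom A c).toFun z] := by
    intro x y z
    funext i
    fin_cases i <;> rfl
  rw [e, e]
  exact h1

theorem mem_quot_mono (V : Variety σ) {A : Alg σ} (c e : Congruence A) (h : c ≤ e)
    (hm : V.Mem (quotAlg A c)) : V.Mem (quotAlg A e) := by
  refine V.closed_hom hm ⟨⟨Quotient.lift (fun a => (mkHom A e).toFun a)
    (fun a b k => (mk_eq e).2 (h _ _ k)), ?_⟩, ?_⟩
  · intro f a
    obtain ⟨a, rfl⟩ : ∃ a' : Fin (σ.arity f) → A.carrier, a = fun i => (mkHom A c).toFun (a' i) :=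
      ⟨fun i => (a i).out, funext fun i => (Quotient.out_eq (a i)).symm⟩
    rw [← (mkHom A c).map_op]
    exact (mkHom A e).map_op f a
  · intro x
    obtain ⟨a, rfl⟩ := mk_surj e x
    exact ⟨(mkHom A c).toFun a, rfl⟩

/-- `S,T`-matrices, described as a generated subalgebra of `A^4`. -/
inductive Mat {A : Alg σ} (S T : Congruence A) :
    A.carrier → A.carrier → A.carrier → A.carrier → Prop
  | row (a b : A.carrier) : S.rel a b → Mat S T a a b b
  | col (u v : A.carrier) : T.rel u v → Mat S T u v u v
  | op (f : σ.ops) (p q r s : Fin (σ.arity f) → A.carrier) :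
      (∀ i, Mat S T (p i) (q i) (r i) (s i)) →
      Mat S T (A.interp f p) (A.interp f q) (A.interp f r) (A.interp f s)

theorem Mat.eval {A : Alg σ} {S T : Congruence A} {W : Type} (t : Trm σ W)
    (p q r s : W → A.carrier) (h : ∀ i, Mat S T (p i) (q i) (r i) (s i)) :
    Mat S T (A.evalTrm p t) (A.evalTrm q t) (A.evalTrm r t) (A.evalTrm s t) := by
  induction t with
  | var v => exact h v
  | op f ts ih => exact Mat.op f _ _ _ _ ih

theorem Mat.rows {A : Alg σ} {S T : Congruence A} {p q r s : A.carrier}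
    (h : Mat S T p q r s) : S.rel p r ∧ S.rel q s := by
  induction h with
  | row a b h => exact ⟨h, h⟩
  | col u v h => exact ⟨S.iseqv.refl _, S.iseqv.refl _⟩
  | op f p q r s h ih => exact ⟨S.compat f _ _ fun i => (ih i).1, S.compat f _ _ fun i => (ih i).2⟩

theorem Mat.term {A : Alg σ} {S T : Congruence A} {p q r s : A.carrier}
    (h : Mat S T p q r s) :
    ∃ (m n : ℕ) (t : Trm σ (Sum (Fin m) (Fin n)))
      (a b : Fin m → A.carrier) (u v : Fin n → A.carrier),
      (∀ i, S.rel (a i) (b i)) ∧ (∀ j, T.rel (u j) (v j)) ∧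
      p = A.evalTrm (Sum.elim a u) t ∧ q = A.evalTrm (Sum.elim a v) t ∧
      r = A.evalTrm (Sum.elim b u) t ∧ s = A.evalTrm (Sum.elim b v) t := by
  induction h with
  | row a b h =>
    exact ⟨1, 0, Trm.var (Sum.inl 0), fun _ => a, fun _ => b, Fin.elim0, Fin.elim0,
      fun _ => h, fun j => j.elim0, rfl, rfl, rfl, rfl⟩
  | col u v h =>
    exact ⟨0, 1, Trm.var (Sum.inr 0), Fin.elim0, Fin.elim0, fun _ => u, fun _ => v,
      fun j => j.elim0, fun _ => h, rfl, rfl, rfl, rfl⟩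
  | op f p q r s h ih =>
    choose m n t a b u v hab huv hp hq hr hs using ih
    let eI := Fintype.equivFin (Σ i, Fin (m i))
    let eJ := Fintype.equivFin (Σ i, Fin (n i))
    have key : ∀ (a : ∀ i, Fin (m i) → A.carrier) (u : ∀ i, Fin (n i) → A.carrier)
        (p : Fin (σ.arity f) → A.carrier)
        (_ : ∀ i, p i = A.evalTrm (Sum.elim (a i) (u i)) (t i)),
        A.interp f p = A.evalTrm
          (Sum.elim (fun k => a (eI.symm k).1 (eI.symm k).2)
            (fun k => u (eJ.symm k).1 (eJ.symm k).2))
          (Trm.op f fun i => (termAlg σ _).evalTrm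
            (Sum.elim (fun k => Trm.var (Sum.inl (eI ⟨i, k⟩)))
              (fun k => Trm.var (Sum.inr (eJ ⟨i, k⟩)))) (t i)) := by
      intro a u p hp
      simp only [Alg.evalTrm]
      congr 1
      funext i
      rw [hp, eval_subst]
      congr 1
      funext k
      rcases k with k | k
      · have hk := eI.symm_apply_apply ⟨i, k⟩
        simp only [Alg.evalTrm, Sum.elim_inl]
        rw [hk]
      · have hk := eJ.symm_apply_apply ⟨i, k⟩
        simp only [Alg.evalTrm, Sum.elim_inr]
        rw [hk]
    exact ⟨_, _, _, _, _, _, _, fun k => hab (eI.symm k).1 (eI.symm k).2,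
      fun k => huv (eJ.symm k).1 (eJ.symm k).2,
      key a u p hp, key a v q hq, key b u r hr, key b v s hs⟩

theorem Mat.centralizes {A : Alg σ} {S T c : Congruence A} (hC : Centralizes S T c)
    {p q r s : A.carrier} (h : Mat S T p q r s) (hpq : c.rel p q) : c.rel r s := by
  obtain ⟨m, n, t, a, b, u, v, hab, huv, rfl, rfl, rfl, rfl⟩ := h.term
  exact hC m n t a b u v hab huv hpq

theorem Mat.of_term {A : Alg σ} {S T : Congruence A} {m n : ℕ} (t : Trm σ (Sum (Fin m) (Fin n)))
    (a b : Fin m → A.carrier) (u v : Fin n → A.carrier)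
    (hab : ∀ i, S.rel (a i) (b i)) (huv : ∀ j, T.rel (u j) (v j)) :
    Mat S T (A.evalTrm (Sum.elim a u) t) (A.evalTrm (Sum.elim a v) t)
      (A.evalTrm (Sum.elim b u) t) (A.evalTrm (Sum.elim b v) t) := by
  apply Mat.eval
  rintro (i | i)
  · exact Mat.row _ _ (hab i)
  · exact Mat.col _ _ (huv i)

/-- In a matrix, three entries determine the fourth one through `d`. -/
theorem mat_diff {A : Alg σ} {S T c : Congruence A} (d : Trm σ (Fin 3)) (hST : S ≤ T)
    (hd : ∀ a b, S.rel a b → c.rel (A.evalTrm ![a, a, b] d) b ∧ c.rel (A.evalTrm ![a, b, b] d) a)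
    (hC : Centralizes S T c) {p q r s : A.carrier} (h : Mat S T p q r s) (hpq : S.rel p q) :
    c.rel (A.evalTrm ![r, p, q] d) s := by
  have hM : Mat S T (A.evalTrm ![p, p, q] d) (A.evalTrm ![q, q, q] d)
      (A.evalTrm ![r, p, q] d) (A.evalTrm ![s, q, q] d) := by
    apply Mat.eval
    intro i
    fin_cases i
    · exact h
    · exact Mat.col _ _ (hST _ _ hpq)
    · exact Mat.row _ _ (S.iseqv.refl _)
  have h1 := hM.centralizes hC
    (c.iseqv.trans (hd p q hpq).1 (c.iseqv.symm (hd q q (S.iseqv.refl q)).1))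
  exact c.iseqv.trans h1 (hd s q (S.iseqv.symm h.rows.2)).2

/-- Compatibility may be checked one coordinate at a time. -/
theorem compat_of_update {A : Alg σ} (R : A.carrier → A.carrier → Prop) (hR : Equivalence R)
    (h : ∀ (f : σ.ops) (x : Fin (σ.arity f) → A.carrier) (i : Fin (σ.arity f)) (s t : A.carrier),
      R s t → R (A.interp f (Function.update x i s)) (A.interp f (Function.update x i t)))
    (f : σ.ops) (a b : Fin (σ.arity f) → A.carrier) (hab : ∀ i, R (a i) (b i)) :
    R (A.interp f a) (A.interp f b) := by
  have key : ∀ F : Finset (Fin (σ.arity f)),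
      R (A.interp f a) (A.interp f fun i => if i ∈ F then b i else a i) := by
    intro F
    induction F using Finset.induction_on with
    | empty => simpa using hR.refl _
    | insert j F hj ih =>
      refine hR.trans ih ?_
      have := h f (fun i => if i ∈ F then b i else a i) j (a j) (b j) (hab j)
      convert this using 2
      · funext i
        by_cases hi : i = j
        · subst hi
          simp [hj]
        · simp [hi]
      · funext i
        by_cases hi : i = j
        · subst hi
          simp
        · simp [hi]
  simpa using key Finset.univ

/-! ### The congruences on the term algebra in three variables -/

/-- `s(x,x,y) ≈ t(x,x,y)` holds in the variety. -/
def E1 (V : Variety σ) : Congruence (termAlg σ (Fin 3)) where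
  rel s t := ∀ A : Alg σ, V.Mem A → ∀ a b : A.carrier,
    A.evalTrm ![a, a, b] s = A.evalTrm ![a, a, b] t
  iseqv := ⟨fun _ _ _ _ _ => rfl, fun h A hA a b => (h A hA a b).symm,
    fun h k A hA a b => (h A hA a b).trans (k A hA a b)⟩
  compat f s t h A hA a b := congrArg (A.interp f) (funext fun i => h i A hA a b)

/-- `s(a,b,b) = t(a,b,b)` whenever `(a,b)` is in an abelian congruence. -/
def E2 (V : Variety σ) : Congruence (termAlg σ (Fin 3)) where
  rel s t := ∀ A : Alg σ, V.Mem A → ∀ α : Congruence A, IsAbelianCong α →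
    ∀ a b : A.carrier, α.rel a b → A.evalTrm ![a, b, b] s = A.evalTrm ![a, b, b] t
  iseqv := ⟨fun _ _ _ _ _ _ _ _ => rfl, fun h A hA α hα a b k => (h A hA α hα a b k).symm,
    fun h k A hA α hα a b l => (h A hA α hα a b l).trans (k A hA α hα a b l)⟩
  compat f s t h A hA α hα a b k := congrArg (A.interp f) (funext fun i => h i A hA α hα a b k)

/-- The intersection of `E1` and `E2`. -/
def E (V : Variety σ) : Congruence (termAlg σ (Fin 3)) where
  rel s t := (E1 V).rel s t ∧ (E2 V).rel s t
  iseqv := ⟨fun _ => ⟨(E1 V).iseqv.refl _, (E2 V).iseqv.refl _⟩,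
    fun h => ⟨(E1 V).iseqv.symm h.1, (E2 V).iseqv.symm h.2⟩,
    fun h k => ⟨(E1 V).iseqv.trans h.1 k.1, (E2 V).iseqv.trans h.2 k.2⟩⟩
  compat f s t h := ⟨(E1 V).compat f s t fun i => (h i).1, (E2 V).compat f s t fun i => (h i).2⟩

/-- `s(x,x,x) ≈ t(x,x,x)` holds in the variety. -/
def Th (V : Variety σ) : Congruence (termAlg σ (Fin 3)) where
  rel s t := ∀ A : Alg σ, V.Mem A → ∀ a : A.carrier,
    A.evalTrm ![a, a, a] s = A.evalTrm ![a, a, a] t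
  iseqv := ⟨fun _ _ _ _ => rfl, fun h A hA a => (h A hA a).symm,
    fun h k A hA a => (h A hA a).trans (k A hA a)⟩
  compat f s t h A hA a := congrArg (A.interp f) (funext fun i => h i A hA a)

theorem isAbelian_bot {A : Alg σ} : IsAbelianCong (⊥ : Congruence A) := by
  apply commC_eq_bot.2
  intro m n t a b u v _ huv _
  rw [bot_rel]
  congr 1
  funext i
  rcases i with i | i
  · rfl
  · exact bot_rel.1 (huv i)

theorem E_le_E1 (V : Variety σ) : E V ≤ E1 V := fun _ _ h => h.1
theorem E_le_E2 (V : Variety σ) : E V ≤ E2 V := fun _ _ h => h.2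
theorem E1_le_Th (V : Variety σ) : E1 V ≤ Th V := fun _ _ h A hA a => h A hA a a
theorem E2_le_Th (V : Variety σ) : E2 V ≤ Th V :=
  fun _ _ h A hA a => h A hA ⊥ isAbelian_bot a a (bot_rel.2 rfl)

theorem mem_E (V : Variety σ) : V.Mem (quotAlg (termAlg σ (Fin 3)) (E V)) := by
  classical
  let I := {p : Trm σ (Fin 3) × Trm σ (Fin 3) // ¬ (E V).rel p.1 p.2}
  have hI : ∀ i : I, ∃ (A : Alg σ) (asg : Fin 3 → A.carrier), V.Mem A ∧
      (∀ s t, (E V).rel s t → A.evalTrm asg s = A.evalTrm asg t) ∧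
      A.evalTrm asg i.1.1 ≠ A.evalTrm asg i.1.2 := by
    rintro ⟨⟨s, t⟩, h⟩
    by_cases h1 : (E1 V).rel s t
    · have h2 : ¬ (E2 V).rel s t := fun h2 => h ⟨h1, h2⟩
      simp only [E2] at h2
      push Not at h2
      obtain ⟨A, hA, α, hα, a, b, hab, hne⟩ := h2
      exact ⟨A, ![a, b, b], hA, fun s t k => k.2 A hA α hα a b hab, hne⟩
    · simp only [E1] at h1
      push Not at h1
      obtain ⟨A, hA, a, b, hne⟩ := h1
      exact ⟨A, ![a, a, b], hA, fun s t k => k.1 A hA a b, hne⟩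
  choose A asg hA hE hne using hI
  refine V.closed_sub (V.closed_prod A hA) ⟨⟨Quotient.lift
    (fun s i => (A i).evalTrm (asg i) s) (fun s t k => funext fun i => hE i s t k), ?_⟩, ?_⟩
  · intro f a
    funext i
    change (A i).evalTrm (asg i) (Trm.op f fun j => (a j).out) = _
    simp only [Alg.evalTrm, prodAlg]
    congr 1
    funext j
    conv_rhs => rw [← Quotient.out_eq (a j)]
    rfl
  · rintro ⟨s⟩ ⟨t⟩ h
    apply Quotient.sound
    by_contra hn
    exact hne ⟨(s, t), hn⟩ (congrFun h _)

theorem centralizes_Th_E2 (V : Variety σ) : Centralizes (Th V) (Th V) (E2 V) := by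
  intro m n t p q u v hpq huv h A hA α hα a b hab
  have key : ∀ s t : Trm σ (Fin 3), (Th V).rel s t →
      α.rel (A.evalTrm ![a, b, b] s) (A.evalTrm ![a, b, b] t) := by
    intro s t hst
    have h1 : ∀ s : Trm σ (Fin 3), α.rel (A.evalTrm ![a, b, b] s) (A.evalTrm ![b, b, b] s) := by
      intro s
      apply rel_eval
      intro i
      fin_cases i
      · exact hab
      · exact α.iseqv.refl _
      · exact α.iseqv.refl _
    have h2 := h1 s
    rw [hst A hA b] at h2
    exact α.iseqv.trans h2 (α.iseqv.symm (h1 t))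
  have e : ∀ (p : Fin m → Trm σ (Fin 3)) (u : Fin n → Trm σ (Fin 3)),
      A.evalTrm ![a, b, b] ((termAlg σ (Fin 3)).evalTrm (Sum.elim p u) t)
      = A.evalTrm (Sum.elim (fun i => A.evalTrm ![a, b, b] (p i))
          (fun i => A.evalTrm ![a, b, b] (u i))) t := by
    intro p u
    rw [eval_subst]
    congr 1
    funext i
    rcases i with i | i <;> rfl
  have h1 := h A hA α hα a b hab
  rw [e, e] at h1 ⊢
  exact bot_rel.1 (commC_eq_bot.1 hα m n t _ _ _ _ (fun i => key _ _ (hpq i))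
    (fun i => key _ _ (huv i)) (bot_rel.2 h1))

theorem centralizes_Th_E1 (V : Variety σ) : Centralizes (Th V) (E1 V) (E V) := by
  intro m n t p q u v hpq huv h
  refine ⟨?_, centralizes_Th_E2 V m n t p q u v hpq (fun j => E1_le_Th V _ _ (huv j)) h.2⟩
  apply rel_eval
  rintro (i | i)
  · exact (E1 V).iseqv.refl _
  · exact huv i

/-- Applying a unary polynomial of the term algebra. -/
def papp (t : Trm σ (Option (Fin 3))) (s : Trm σ (Fin 3)) : Trm σ (Fin 3) :=
  (termAlg σ (Fin 3)).evalTrm (fun o => o.elim s Trm.var) t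

theorem papp_rel (c : Congruence (termAlg σ (Fin 3))) (t : Trm σ (Option (Fin 3)))
    (s s' : Trm σ (Fin 3)) (h : c.rel s s') : c.rel (papp t s) (papp t s') := by
  apply rel_eval
  rintro (_ | i)
  · exact h
  · exact c.iseqv.refl _

theorem eval_papp (A : Alg σ) (asg : Fin 3 → A.carrier) (t : Trm σ (Option (Fin 3)))
    (s : Trm σ (Fin 3)) :
    A.evalTrm asg (papp t s) = A.evalTrm (fun o => o.elim (A.evalTrm asg s) asg) t := by
  unfold papp
  rw [eval_subst]
  congr 1
  funext o
  rcases o with _ | i <;> rfl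

/-- The possible values of the second coordinate over `y`. -/
def N (V : Variety σ) (c : Trm σ (Fin 3)) : Prop :=
  ∃ p : Trm σ (Fin 3), (E1 V).rel p (Trm.var 2) ∧ (E2 V).rel p c

theorem N_congr (V : Variety σ) {c e : Trm σ (Fin 3)} (h : (E2 V).rel c e) : N V c ↔ N V e :=
  ⟨fun ⟨p, h1, h2⟩ => ⟨p, h1, (E2 V).iseqv.trans h2 h⟩,
    fun ⟨p, h1, h2⟩ => ⟨p, h1, (E2 V).iseqv.trans h2 ((E2 V).iseqv.symm h)⟩⟩

/-- The congruence used to analyze the congruence generated by one pair. -/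
def Gam (V : Variety σ) : Congruence (termAlg σ (Fin 3)) :=
  have hR : Equivalence (fun s t : Trm σ (Fin 3) => (E1 V).rel s t ∧
      ∀ g : Trm σ (Option (Fin 3)), (E1 V).rel (papp g s) (Trm.var 0) →
        (N V (papp g s) ↔ N V (papp g t))) := by
    refine ⟨fun s => ⟨(E1 V).iseqv.refl s, fun _ _ => Iff.rfl⟩, ?_, ?_⟩
    · rintro s t ⟨h1, h2⟩
      exact ⟨(E1 V).iseqv.symm h1, fun g hg =>
        (h2 g ((E1 V).iseqv.trans (papp_rel _ g _ _ h1) hg)).symm⟩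
    · rintro s t r ⟨h1, h2⟩ ⟨h3, h4⟩
      exact ⟨(E1 V).iseqv.trans h1 h3, fun g hg => (h2 g hg).trans
        (h4 g ((E1 V).iseqv.trans ((E1 V).iseqv.symm (papp_rel _ g _ _ h1)) hg))⟩
  { rel := fun s t : Trm σ (Fin 3) => (E1 V).rel s t ∧
      ∀ g : Trm σ (Option (Fin 3)), (E1 V).rel (papp g s) (Trm.var 0) →
        (N V (papp g s) ↔ N V (papp g t))
    iseqv := hR
    compat := by
      refine fun f a b h => compat_of_update (A := termAlg σ (Fin 3)) _ hR ?_ f a b h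
      clear h a b f
      rintro f x i s t ⟨h1, h2⟩
      refine ⟨?_, ?_⟩
      · apply (E1 V).compat
        intro j
        by_cases hj : j = i
        · subst hj
          simpa using h1
        · simpa [hj] using (E1 V).iseqv.refl _
      · intro g
        let g' : Trm σ (Option (Fin 3)) := (termAlg σ (Option (Fin 3))).evalTrm
          (fun o => o.elim (Trm.op f (Function.update
            (fun j => (termAlg σ (Option (Fin 3))).evalTrm (fun k => Trm.var (some k)) (x j))
            i (Trm.var none))) (fun k => Trm.var (some k))) g
        have hvar : ∀ z : Trm σ (Fin 3), (termAlg σ (Fin 3)).evalTrm Trm.var z = z := by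
          intro z
          induction z with
          | var v => rfl
          | op f ts ih => exact congrArg (Trm.op f) (funext ih)
        have e : ∀ s : Trm σ (Fin 3),
            papp g ((termAlg σ (Fin 3)).interp f (Function.update x i s)) = papp g' s := by
          intro s
          unfold papp
          rw [eval_subst]
          congr 1
          funext o
          rcases o with _ | k
          · simp only [Option.elim_none, Alg.evalTrm]
            congr 1
            funext j
            by_cases hj : j = i
            · subst hj
              simp [Alg.evalTrm]
            · simp only [Function.update_of_ne hj]
              rw [eval_subst]
              exact (hvar (x j)).symm
          · rfl
        rw [e, e]
        exact h2 g' }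

/-- Substitution into a ternary term. -/
def dd (d x y z : Trm σ (Fin 3)) : Trm σ (Fin 3) := (termAlg σ (Fin 3)).evalTrm ![x, y, z] d

theorem eval_dd (A : Alg σ) (asg : Fin 3 → A.carrier) (d x y z : Trm σ (Fin 3)) :
    A.evalTrm asg (dd d x y z)
      = A.evalTrm ![A.evalTrm asg x, A.evalTrm asg y, A.evalTrm asg z] d := by
  unfold dd
  rw [eval_subst]
  congr 1
  funext i
  fin_cases i <;> rfl

theorem dd_rel (c : Congruence (termAlg σ (Fin 3))) (d : Trm σ (Fin 3))
    {x y z x' y' z' : Trm σ (Fin 3)} (hx : c.rel x x') (hy : c.rel y y') (hz : c.rel z z') :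
    c.rel (dd d x y z) (dd d x' y' z') := by
  apply rel_eval
  intro i
  fin_cases i
  · exact hx
  · exact hy
  · exact hz

theorem wdt_idem (V : Variety σ) (d : Trm σ (Fin 3)) (hd : IsWeakDifferenceTrm V d)
    (A : Alg σ) (hA : V.Mem A) (a : A.carrier) : A.evalTrm ![a, a, a] d = a :=
  (hd A hA ⊥ isAbelian_bot a a (bot_rel.2 rfl)).1

/-- The key step: translations preserve `N`. -/
theorem key_step (V : Variety σ) (d : Trm σ (Fin 3)) (hd : IsWeakDifferenceTrm V d)
    (g : Trm σ (Option (Fin 3))) (k k' m m' : Trm σ (Fin 3))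
    (hkk : (Th V).rel k k')
    (hm : (E2 V).rel m k) (hm' : (E2 V).rel m' k')
    (h1 : (E1 V).rel ((termAlg σ (Fin 3)).evalTrm
      (fun o : Option (Fin 3) => o.elim m ![Trm.var 2, Trm.var 2, Trm.var 1]) g) (Trm.var 2))
    (h2 : (E1 V).rel ((termAlg σ (Fin 3)).evalTrm
      (fun o : Option (Fin 3) => o.elim m' ![Trm.var 2, Trm.var 2, Trm.var 1]) g) (Trm.var 2))
    (hN : N V (papp g k)) : N V (papp g k') := by
  obtain ⟨p, hp1, hp2⟩ := hN
  have hmE2 := mem_quot_mono V _ _ (E_le_E2 V) (mem_E V)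
  have hT : ∀ i j : Fin 3, (Th V).rel (Trm.var i) (Trm.var j) := by
    intro i j A hA a
    fin_cases i <;> fin_cases j <;> rfl
  have hmm : (Th V).rel m m' :=
    (Th V).iseqv.trans (E2_le_Th V _ _ hm)
      ((Th V).iseqv.trans hkk ((Th V).iseqv.symm (E2_le_Th V _ _ hm')))
  have hM : Mat (Th V) (Th V)
      ((termAlg σ (Fin 3)).evalTrm
        (fun o : Option (Fin 3) => o.elim m ![Trm.var 2, Trm.var 2, Trm.var 1]) g)
      ((termAlg σ (Fin 3)).evalTrm
        (fun o : Option (Fin 3) => o.elim m' ![Trm.var 2, Trm.var 2, Trm.var 1]) g)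
      (papp g m) (papp g m') := by
    apply Mat.eval
    rintro (_ | i)
    · exact Mat.col _ _ hmm
    · apply Mat.row
      fin_cases i <;> exact hT _ _
  have h := mat_diff d le_rfl
    (wdt_quot V d hd (E2 V) (Th V) hmE2 (E2_le_Th V) (centralizes_Th_E2 V))
    (centralizes_Th_E2 V) hM (by
      apply rel_eval
      rintro (_ | i)
      · exact hmm
      · exact (Th V).iseqv.refl _)
  refine ⟨dd d p _ _, ?_, (E2 V).iseqv.trans (dd_rel (E2 V) d ?_ ((E2 V).iseqv.refl _)
    ((E2 V).iseqv.refl _)) ((E2 V).iseqv.trans h (papp_rel _ g _ _ hm'))⟩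
  · refine (E1 V).iseqv.trans (dd_rel (E1 V) d hp1 h1 h2) ?_
    intro A hA a b
    rw [eval_dd]
    exact wdt_idem V d hd A hA _
  · exact (E2 V).iseqv.trans hp2 ((E2 V).iseqv.symm (papp_rel _ g _ _ hm))

theorem gam_pair (V : Variety σ) (d : Trm σ (Fin 3)) (hd : IsWeakDifferenceTrm V d) :
    (Gam V).rel (dd d (Trm.var 0) (Trm.var 1) (Trm.var 2))
      (dd d (Trm.var 1) (Trm.var 1) (Trm.var 2)) := by
  have hE1 : (E1 V).rel (dd d (Trm.var 0) (Trm.var 1) (Trm.var 2))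
      (dd d (Trm.var 1) (Trm.var 1) (Trm.var 2)) := by
    intro A hA a b
    rw [eval_dd, eval_dd]
    rfl
  refine ⟨hE1, fun g hg => ?_⟩
  have ha : (E2 V).rel (dd d (Trm.var 2) (Trm.var 2) (Trm.var 0))
      (dd d (Trm.var 0) (Trm.var 1) (Trm.var 2)) := by
    intro A hA α hα a b hab
    rw [eval_dd, eval_dd]
    exact ((hd A hA α hα b a (α.iseqv.symm hab)).1).trans (hd A hA α hα a b hab).2.symm
  have hb : (E2 V).rel (dd d (Trm.var 2) (Trm.var 2) (Trm.var 1))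
      (dd d (Trm.var 1) (Trm.var 1) (Trm.var 2)) := by
    intro A hA α hα a b hab
    rw [eval_dd, eval_dd]
    rfl
  have hx : ∀ j : Fin 3, j ≠ 2 → (E1 V).rel ((termAlg σ (Fin 3)).evalTrm
      (fun o : Option (Fin 3) => o.elim (dd d (Trm.var 2) (Trm.var 2) (Trm.var j))
        ![Trm.var 2, Trm.var 2, Trm.var 1]) g) (Trm.var 2) := by
    intro j hj A hA a b
    have h := hg A hA b a
    rw [eval_papp, eval_dd] at h
    rw [eval_subst]
    refine Eq.trans ?_ h
    congr 1
    funext o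
    rcases o with _ | i
    · change A.evalTrm ![a, a, b] (dd d _ _ _) = _
      rw [eval_dd]
      fin_cases j
      · rfl
      · rfl
      · exact absurd rfl hj
    · fin_cases i <;> rfl
  have hTh := E1_le_Th V _ _ hE1
  exact ⟨key_step V d hd g _ _ _ _ hTh ha hb (hx 0 (by decide)) (hx 1 (by decide)),
    key_step V d hd g _ _ _ _ ((Th V).iseqv.symm hTh) hb ha (hx 1 (by decide)) (hx 0 (by decide))⟩

end CPW

/-- If a variety `V` has a weak difference term and the commutator is
commutative on pairs of comparable congruences, then `V` has a difference
term. -/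
theorem commutative_plus_weak {σ : Sig} (V : Variety σ)
    (hw : ∃ d : Trm σ (Fin 3), IsWeakDifferenceTrm V d)
    (hcomm : ∀ A : Alg σ, V.Mem A → ∀ x y : Congruence A, x ≤ y →
      commC x y = commC y x) :
    ∃ d : Trm σ (Fin 3), IsDifferenceTrm V d := by
  obtain ⟨d, hd⟩ := hw
  have hC1 := (CPW.centralizes_swap V hcomm (CPW.E V) (CPW.E1 V) (CPW.Th V) (CPW.mem_E V)
    (CPW.E_le_E1 V) (CPW.E1_le_Th V)).2 (CPW.centralizes_Th_E1 V)
  have hC11 : Centralizes (CPW.E1 V) (CPW.E1 V) (CPW.E V) := by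
    intro m n t a b u v hab huv h
    exact hC1 m n t a b u v hab (fun j => CPW.E1_le_Th V _ _ (huv j)) h
  have hdE := CPW.wdt_quot V d hd (CPW.E V) (CPW.E1 V) (CPW.mem_E V) (CPW.E_le_E1 V) hC11
  let δ : Congruence (CPW.termAlg σ (Fin 3)) := sInf {c | CPW.E V ≤ c ∧
    c.rel (CPW.dd d (Trm.var 0) (Trm.var 1) (Trm.var 2))
      (CPW.dd d (Trm.var 1) (Trm.var 1) (Trm.var 2))}
  have hEδ : CPW.E V ≤ δ := le_sInf fun c hc => hc.1
  have hδ : δ.rel (CPW.dd d (Trm.var 0) (Trm.var 1) (Trm.var 2))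
      (CPW.dd d (Trm.var 1) (Trm.var 1) (Trm.var 2)) := fun c hc => hc.2
  have hpair := CPW.gam_pair V d hd
  have hδ1 : δ ≤ CPW.E1 V := sInf_le ⟨CPW.E_le_E1 V, hpair.1⟩
  have hδG : δ ≤ CPW.Gam V := sInf_le ⟨fun s t h => ⟨h.1, fun g _ =>
    CPW.N_congr V (CPW.papp_rel _ g _ _ h.2)⟩, hpair⟩
  have hC2 : Centralizes (CPW.E1 V) (CPW.Th V) δ := by
    intro m n t a b u v hab huv h
    have hM := CPW.Mat.of_term t a b u v hab huv
    have h1 := CPW.mat_diff d (CPW.E1_le_Th V) hdE hC1 hM (hδ1 _ _ h)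
    have h2 := (hdE _ _ ((CPW.E1 V).iseqv.symm hM.rows.1)).2
    refine δ.iseqv.trans (δ.iseqv.symm (hEδ _ _ h2)) (δ.iseqv.trans ?_ (hEδ _ _ h1))
    exact CPW.dd_rel δ d (δ.iseqv.refl _) (δ.iseqv.refl _) h
  have hC3 := (CPW.centralizes_swap V hcomm δ (CPW.E1 V) (CPW.Th V)
    (CPW.mem_quot_mono V _ _ hEδ (CPW.mem_E V)) hδ1 (CPW.E1_le_Th V)).1 hC2
  have h01 : (CPW.E1 V).rel (Trm.var 0) (Trm.var 1) := fun _ _ _ _ => rfl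
  have hM : CPW.Mat (CPW.Th V) (CPW.E1 V)
      (CPW.dd d (Trm.var 0) (Trm.var 1) (Trm.var 2)) (CPW.dd d (Trm.var 1) (Trm.var 1) (Trm.var 2))
      (CPW.dd d (Trm.var 0) (Trm.var 1) (Trm.var 1))
      (CPW.dd d (Trm.var 1) (Trm.var 1) (Trm.var 1)) := by
    apply CPW.Mat.eval
    intro i
    fin_cases i
    · exact CPW.Mat.col _ _ h01
    · exact CPW.Mat.row _ _ ((CPW.Th V).iseqv.refl _)
    · exact CPW.Mat.row _ _ (fun _ _ _ => rfl)
  have h3 := hM.centralizes hC3 hδ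
  have h4 : δ.rel (Trm.var 0) (Trm.var 1) :=
    δ.iseqv.trans (δ.iseqv.symm (hEδ _ _ (hdE _ _ h01).2)) (δ.iseqv.trans h3
      (hEδ _ _ (hdE (Trm.var 1) (Trm.var 1) ((CPW.E1 V).iseqv.refl _)).1))
  have h5 := (hδG _ _ h4).2 (Trm.var none) ((CPW.E1 V).iseqv.refl _)
  obtain ⟨p, hp1, hp2⟩ : CPW.N V (Trm.var 0) :=
    h5.2 ⟨Trm.var 2, (CPW.E1 V).iseqv.refl _, fun _ _ _ _ _ _ _ => rfl⟩
  exact ⟨p, fun A hA a b => hp1 A hA a b, fun A hA α hα a b hab => hp2 A hA α hα a b hab⟩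
end
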